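/- There is a constant c > 0 such that the following holds. Let G be a finite simple triconnected graph with a fixed plane embedding Φ, and let 𝒫 be any set of faces of Φ. Then the number of vertices of G which lie on the boundaries of at least two faces in 𝒫 is at most c·|𝒫|. -/

import Mathlib

open Set Topology

/-- A plane embedding of a simple graph `G`: an injective placement of the vertices in the
plane together with, for each edge, an arc (the image of an injective continuous path) whose
endpoints are the images of the endpoints of the edge, such that two distinct arcs intersect
only in images of common endpoints and an arc meets the image of a vertex only if that vertex
is an endpoint of the corresponding edge. -/
structure PlaneEmbedding {V : Type*} (G : SimpleGraph V) where
  vmap : V → ℝ × ℝ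
  vmap_inj : Function.Injective vmap
  arc : G.edgeSet → Set (ℝ × ℝ)
  arc_path : ∀ e : G.edgeSet, ∃ f : unitInterval → ℝ × ℝ,
    Continuous f ∧ Function.Injective f ∧ Set.range f = arc e ∧
    ∃ u v : V, (e : Sym2 V) = s(u, v) ∧ f 0 = vmap u ∧ f 1 = vmap v
  arc_inter : ∀ e e' : G.edgeSet, e ≠ e' →
    arc e ∩ arc e' ⊆ vmap '' {x : V | x ∈ (e : Sym2 V) ∧ x ∈ (e' : Sym2 V)}
  vmap_mem_arc : ∀ (e : G.edgeSet) (x : V), vmap x ∈ arc e → x ∈ (e : Sym2 V)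

namespace PlaneEmbedding

variable {V : Type*} {G : SimpleGraph V}

/-- The union of all arcs of the embedding. -/
def drawing (Φ : PlaneEmbedding G) : Set (ℝ × ℝ) :=
  ⋃ e : G.edgeSet, Φ.arc e

/-- The faces of the embedding: connected components of the complement of the drawing. -/
def IsFace (Φ : PlaneEmbedding G) (F : Set (ℝ × ℝ)) : Prop :=
  ∃ p ∈ Φ.drawingᶜ, F = connectedComponentIn Φ.drawingᶜ p

/-- The vertex `v` lies on the boundary of the face `F`. -/
def OnFace (Φ : PlaneEmbedding G) (F : Set (ℝ × ℝ)) (v : V) : Prop :=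
  Φ.vmap v ∈ frontier F

/-- The embedding satisfies a family `C` of vertex subsets: some face has on its boundary
at least one vertex from each set in `C`. -/
def SatisfiesFam (Φ : PlaneEmbedding G) (C : Set (Set V)) : Prop :=
  ∃ F : Set (ℝ × ℝ), Φ.IsFace F ∧ ∀ U ∈ C, ∃ v ∈ U, Φ.OnFace F v

end PlaneEmbedding

/-- A graph is planar if it has a plane embedding. -/
def Planar {V : Type*} (G : SimpleGraph V) : Prop :=
  Nonempty (PlaneEmbedding G)
/-- A cut vertex: a vertex whose removal increases the number of connected components. -/
def IsCutVertex {V : Type*} (G : SimpleGraph V) (w : V) : Prop :=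
  Nat.card G.ConnectedComponent < Nat.card ((G.induce {v : V | v ≠ w}).ConnectedComponent)

/-- A graph is biconnected if it is connected, has at least two vertices and no cut vertex. -/
def Biconnected {V : Type*} (G : SimpleGraph V) : Prop :=
  G.Connected ∧ 2 ≤ Nat.card V ∧ ∀ w : V, ¬ IsCutVertex G w

/-- A graph is triconnected if it is biconnected, has at least three vertices, and the removal
of any two vertices cannot disconnect it. -/
def Triconnected {V : Type*} (G : SimpleGraph V) : Prop :=
  Biconnected G ∧ 3 ≤ Nat.card V ∧
    ∀ u v : V, u ≠ v → ((G.induce {x : V | x ≠ u ∧ x ≠ v}).Connected)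
open Set Topology

namespace PF

/-- `x` and `y` are connected inside `U`. -/
def Conn (U : Set ℂ) (x y : ℂ) : Prop := ∃ t ⊆ U, IsPreconnected t ∧ x ∈ t ∧ y ∈ t

theorem Conn.refl {U : Set ℂ} {x : ℂ} (h : x ∈ U) : Conn U x x :=
  ⟨{x}, by simpa using h, isPreconnected_singleton, rfl, rfl⟩

theorem Conn.symm {U : Set ℂ} {x y : ℂ} (h : Conn U x y) : Conn U y x := by
  obtain ⟨t, h1, h2, h3, h4⟩ := h
  exact ⟨t, h1, h2, h4, h3⟩

theorem Conn.trans {U : Set ℂ} {x y z : ℂ} (h : Conn U x y) (h' : Conn U y z) : Conn U x z := by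
  obtain ⟨t, h1, h2, h3, h4⟩ := h
  obtain ⟨t', h1', h2', h3', h4'⟩ := h'
  exact ⟨t ∪ t', union_subset h1 h1', IsPreconnected.union y h4 h3' h2 h2', Or.inl h3, Or.inr h4'⟩

theorem Conn.mono {U U' : Set ℂ} {x y : ℂ} (h : Conn U x y) (hU : U ⊆ U') : Conn U' x y := by
  obtain ⟨t, h1, h2, h3, h4⟩ := h
  exact ⟨t, h1.trans hU, h2, h3, h4⟩

theorem Conn.left {U : Set ℂ} {x y : ℂ} (h : Conn U x y) : x ∈ U := by
  obtain ⟨t, h1, h2, h3, h4⟩ := h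
  exact h1 h3

theorem Conn.right {U : Set ℂ} {x y : ℂ} (h : Conn U x y) : y ∈ U := h.symm.left

theorem conn_iff {U : Set ℂ} {x y : ℂ} (hx : x ∈ U) :
    Conn U x y ↔ y ∈ connectedComponentIn U x := by
  constructor
  · rintro ⟨t, h1, h2, h3, h4⟩
    exact h2.subset_connectedComponentIn h3 h1 h4
  · intro h
    exact ⟨_, connectedComponentIn_subset U x, isPreconnected_connectedComponentIn,
      mem_connectedComponentIn hx, h⟩

theorem isOpen_conn {U : Set ℂ} (hU : IsOpen U) (x : ℂ) : IsOpen {y | Conn U x y} := by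
  by_cases hx : x ∈ U
  · have : {y | Conn U x y} = connectedComponentIn U x := by
      ext y; exact conn_iff hx
    rw [this]; exact hU.connectedComponentIn
  · have : {y | Conn U x y} = ∅ := by
      ext y; simp only [mem_ofPred_eq, mem_empty_iff_false, iff_false]
      exact fun h => hx h.left
    rw [this]; exact isOpen_empty

/-- logarithms on simply connected spaces -/
theorem exists_log {A : Type*} [TopologicalSpace A] [SimplyConnectedSpace A]
    [LocallyPathConnectedSpace A] (a₀ : A) (g : A → ℂ) (hg : Continuous g) (h0 : ∀ a, g a ≠ 0) :
    ∃ L : A → ℂ, Continuous L ∧ ∀ a, Complex.exp (L a) = g a := by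
  obtain ⟨F, ⟨-, h2⟩, -⟩ := Complex.isCoveringMapOn_exp.existsUnique_continuousMap_lifts
    (⟨g, hg⟩ : C(A, ℂ)) (a₀ := a₀) (e₀ := Complex.log (g a₀)) (Complex.exp_log (h0 a₀))
    (fun a => by simpa using h0 a)
  exact ⟨F, F.continuous, fun a => congrFun h2 a⟩

theorem exists_log_I (g : unitInterval → ℂ) (hg : Continuous g) (h0 : ∀ a, g a ≠ 0) :
    ∃ L : unitInterval → ℂ, Continuous L ∧ ∀ a, Complex.exp (L a) = g a := by
  obtain ⟨L, h1, h2⟩ := exists_log (0:ℝ) (fun t => g (projIcc 0 1 zero_le_one t))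
    (hg.comp continuous_projIcc) (fun _ => h0 _)
  exact ⟨fun t => L t, h1.comp continuous_subtype_val, fun t => by simp [h2]⟩

/-- A continuous function on a preconnected set with constant exponential is constant. -/
theorem const_of_exp {A : Type*} [TopologicalSpace A] {s : Set A} (hs : IsPreconnected s)
    {f : A → ℂ} (hf : ContinuousOn f s) (c : ℂ) (h : ∀ a ∈ s, Complex.exp (f a) = c)
    {x y : A} (hx : x ∈ s) (hy : y ∈ s) : f x = f y := by
  refine Complex.isCoveringMap_exp.constOn_of_comp hs hf (fun a ha b hb => ?_) hx hy
  apply Subtype.ext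
  simp [h a ha, h b hb]

/-- On a big circle `(z - x)^a` (`a ≠ 0`) has no continuous logarithm. -/
theorem no_log_circle (x : ℂ) (R : ℝ) (hR : 0 < R) (a : ℤ) (ha : a ≠ 0) (L : ℂ → ℂ)
    (hL : ContinuousOn L (Metric.sphere x R))
    (h : ∀ z ∈ Metric.sphere x R, Complex.exp (L z) = (z - x) ^ a) : False := by
  let c : ℝ → ℂ := fun t => x + Complex.exp (Real.log R + t * Complex.I)
  have hc : ∀ t, c t ∈ Metric.sphere x R := by
    intro t
    simp only [c, Metric.mem_sphere, dist_self_add_left, Complex.norm_exp]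
    simp [Real.exp_log hR]
  have hcc : Continuous c := by fun_prop
  let f : ℝ → ℂ := fun t => L (c t) - a * (Real.log R + t * Complex.I)
  have hf : Continuous f := by
    have : Continuous (fun t => L (c t)) := hL.comp_continuous hcc hc
    exact this.sub (by fun_prop)
  have h1 : ∀ t ∈ (univ : Set ℝ), Complex.exp (f t) = 1 := by
    intro t _
    simp only [f]
    rw [Complex.exp_sub, h _ (hc t)]
    simp only [c, add_sub_cancel_left]
    rw [← Complex.exp_int_mul]
    exact div_self (Complex.exp_ne_zero _)
  have h2 : f 0 = f (2 * Real.pi) :=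
    const_of_exp isPreconnected_univ hf.continuousOn 1 h1 (mem_univ _) (mem_univ _)
  have h3 : c (2 * Real.pi) = c 0 := by
    simp only [c]
    push_cast
    rw [Complex.exp_add, Complex.exp_two_pi_mul_I]
    simp
  simp only [f, h3] at h2
  have h4 : (a : ℂ) * (2 * Real.pi * Complex.I) = 0 := by
    push_cast at h2
    linear_combination h2
  simp [ha, Real.pi_ne_zero] at h4

/-- Log of `(z-x)/(z-y)` on `K` when `x,y` are connected off `K`. -/
theorem log_of_conn {K : Set ℂ} (hK : IsCompact K) {x y : ℂ} (h : Conn Kᶜ x y) :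
    ∃ L : ℂ → ℂ, ContinuousOn L K ∧ ∀ z ∈ K, Complex.exp (L z) * (z - y) = z - x := by
  obtain ⟨t, ht, hc, hx, hy⟩ := h
  let R : ℂ → ℂ → Prop := fun x y =>
    ∃ L : ℂ → ℂ, ContinuousOn L K ∧ ∀ z ∈ K, Complex.exp (L z) * (z - y) = z - x
  have hsymm : ∀ x y, R x y → R y x := by
    rintro x y ⟨L, h1, h2⟩
    refine ⟨fun z => -L z, h1.neg, fun z hz => ?_⟩
    rw [← h2 z hz, ← mul_assoc, ← Complex.exp_add]; simp
  have htrans : ∀ x y z, R x y → R y z → R x z := by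
    rintro x y w ⟨L, h1, h2⟩ ⟨M, h3, h4⟩
    refine ⟨fun z => L z + M z, h1.add h3, fun z hz => ?_⟩
    rw [Complex.exp_add, mul_assoc, h4 z hz, h2 z hz]
  have hloc : ∀ x ∈ Kᶜ, ∃ ε > 0, ∀ y ∈ Metric.ball x ε, R y x := by
    intro x hx
    obtain ⟨ε, hε, hb⟩ := Metric.isOpen_iff.1 hK.isClosed.isOpen_compl x hx
    refine ⟨ε, hε, fun y hy => ?_⟩
    have hslit : ∀ z ∈ K, (z - y) / (z - x) ∈ Complex.slitPlane := by
      intro z hz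
      have h1 : ε ≤ ‖z - x‖ := by
        by_contra hcon
        push Not at hcon
        exact hb (by simpa [dist_eq_norm] using hcon) hz
      have h0 : z - x ≠ 0 := by
        intro h0; rw [h0] at h1; simp at h1; linarith
      have h2 : (z - y) / (z - x) = 1 + (x - y) / (z - x) := by
        field_simp; ring
      rw [h2]
      apply Complex.mem_slitPlane_of_norm_lt_one
      rw [norm_div, div_lt_one (by linarith)]
      have : ‖x - y‖ < ε := by
        rw [← dist_eq_norm, dist_comm]; exact hy
      linarith
    have hne : ∀ z ∈ K, z - x ≠ 0 := by
      intro z hz h0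
      have := hslit z hz
      rw [h0, div_zero] at this
      exact Complex.slitPlane_ne_zero this rfl
    refine ⟨fun z => Complex.log ((z - y) / (z - x)), ?_, ?_⟩
    · apply ContinuousOn.clog _ hslit
      exact ContinuousOn.div (by fun_prop) (by fun_prop) hne
    · intro z hz
      rw [Complex.exp_log (Complex.slitPlane_ne_zero (hslit z hz))]
      exact div_mul_cancel₀ _ (hne z hz)
  have hrefl : ∀ x, R x x := fun x => ⟨fun _ => 0, continuousOn_const, fun z _ => by simp⟩
  -- connectedness
  have key : t ⊆ {w | R x w} := by
    refine hc.subset_of_closure_inter_subset (u := {w | w ∈ Kᶜ ∧ R x w}) ?_ ⟨x, hx, ht hx, hrefl x⟩ ?_ |>.trans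
      (fun w hw => hw.2)
    · rw [Metric.isOpen_iff]
      rintro w ⟨hw, hR⟩
      obtain ⟨ε, hε, h1⟩ := hloc w hw
      obtain ⟨ε₂, hε₂, h2⟩ := Metric.isOpen_iff.1 hK.isClosed.isOpen_compl w hw
      refine ⟨min ε ε₂, lt_min hε hε₂, fun z hz => ⟨h2 ?_, htrans _ _ _ hR (hsymm _ _ (h1 z ?_))⟩⟩
      · exact Metric.ball_subset_ball (min_le_right _ _) hz
      · exact Metric.ball_subset_ball (min_le_left _ _) hz
    · rintro w ⟨hw, hwt⟩
      obtain ⟨ε, hε, h1⟩ := hloc w (ht hwt)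
      obtain ⟨z, hz, hz'⟩ := Metric.mem_closure_iff.1 hw ε hε
      refine ⟨ht hwt, htrans _ _ _ hz.2 (h1 z ?_)⟩
      rw [Metric.mem_ball, dist_comm]; exact hz'
  exact key hy

/-- The extension argument: no logarithm of `(z-x)^a * h` when `x` lies in a bounded
component of the complement. -/
theorem no_log_bounded {K : Set ℂ} (hK : IsCompact K) {x : ℂ} (hx : x ∉ K)
    (hb : Bornology.IsBounded {y | Conn Kᶜ x y}) (a : ℤ) (ha : a ≠ 0) (h : ℂ → ℂ)
    (hhc : ContinuousOn h (K ∪ {y | Conn Kᶜ x y})) (hh0 : ∀ z ∈ K ∪ {y | Conn Kᶜ x y}, h z ≠ 0)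
    (L : ℂ → ℂ) (hL : ContinuousOn L K)
    (hLe : ∀ z ∈ K, Complex.exp (L z) = (z - x) ^ a * h z) : False := by
  set D := {y | Conn Kᶜ x y} with hD
  have hDo : IsOpen D := isOpen_conn hK.isClosed.isOpen_compl x
  have hxD : x ∈ D := Conn.refl hx
  have hfr : frontier D ⊆ K := by
    intro z hz
    by_contra hzK
    have hzo := isOpen_conn hK.isClosed.isOpen_compl z
    have hzc : z ∈ closure D := frontier_subset_closure hz
    obtain ⟨w, hw1, hw2⟩ := mem_closure_iff.1 hzc _ hzo (Conn.refl hzK)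
    have : z ∈ D := Conn.trans hw2 (Conn.symm hw1)
    rw [hDo.frontier_eq] at hz
    exact hz.2 this
  have hcl : closure D ⊆ K ∪ D := by
    intro z hz
    by_cases hzD : z ∈ D
    · exact Or.inr hzD
    · exact Or.inl (hfr (by rw [hDo.frontier_eq]; exact ⟨hz, hzD⟩))
  obtain ⟨L', hL'⟩ := ContinuousMap.exists_restrict_eq hK.isClosed
    (⟨K.domRestrict L, continuousOn_iff_continuous_domRestrict.1 hL⟩ : C(K, ℂ))
  have hL'e : ∀ z ∈ K, L' z = L z := by
    intro z hz
    have := DFunLike.congr_fun hL' ⟨z, hz⟩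
    exact this
  classical
  let g : ℂ → ℂ := fun z => if z ∈ D then Complex.exp (L' z) / h z else (z - x) ^ a
  have hg : Continuous g := by
    apply continuous_if
    · intro z hz
      have hzK := hfr hz
      rw [hL'e z hzK, hLe z hzK]
      exact mul_div_cancel_right₀ _ (hh0 z (Or.inl hzK))
    · apply ContinuousOn.div
      · exact (Complex.continuous_exp.comp L'.continuous).continuousOn
      · exact hhc.mono hcl
      · exact fun z hz => hh0 z (hcl hz)
    · have hcl2 : closure {z | ¬ z ∈ D} = {z | z ∉ D} := by
        exact (hDo.isClosed_compl).closure_eq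
      rw [hcl2]
      apply ContinuousOn.zpow₀ (by fun_prop)
      intro z hz
      left
      intro h0
      apply hz
      rw [sub_eq_zero.1 h0]; exact hxD
  have hg0 : ∀ z, g z ≠ 0 := by
    intro z
    simp only [g]
    split_ifs with hz
    · exact div_ne_zero (Complex.exp_ne_zero _) (hh0 z (Or.inr hz))
    · apply zpow_ne_zero
      intro h0
      apply hz
      rw [sub_eq_zero.1 h0]; exact hxD
  obtain ⟨M, hM, hMe⟩ := exists_log (0:ℂ) g hg hg0
  obtain ⟨R, hR⟩ := hb.subset_ball x
  refine no_log_circle x (max R 1) (by positivity) a ha M hM.continuousOn (fun z hz => ?_)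
  rw [hMe]
  simp only [g]
  rw [if_neg]
  intro hzD
  have h1 := hR hzD
  rw [Metric.mem_ball] at h1
  rw [Metric.mem_sphere] at hz
  have := le_max_left R 1
  linarith

theorem rank_C : 1 < Module.rank ℝ ℂ := by simp

/-- punctured balls, and complements of balls -/
theorem preconn_annulus (x : ℂ) (s : Set ℝ) (hs : s.OrdConnected) (hpos : s ⊆ Ioi 0) :
    IsPreconnected {z : ℂ | ‖z - x‖ ∈ s} := by
  have : {z : ℂ | ‖z - x‖ ∈ s} =
      (fun p : ℝ × ℝ => x + p.1 * Complex.exp (p.2 * Complex.I)) '' (s ×ˢ univ) := by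
    ext z
    constructor
    · intro hz
      refine ⟨(‖z - x‖, Complex.arg (z - x)), ⟨hz, mem_univ _⟩, ?_⟩
      simp [Complex.norm_mul_exp_arg_mul_I]
    · rintro ⟨⟨r, θ⟩, ⟨hr, -⟩, rfl⟩
      have h0 : 0 < r := hpos hr
      have : ‖(r : ℂ) * Complex.exp (θ * Complex.I)‖ = r := by
        rw [norm_mul, Complex.norm_exp_ofReal_mul_I]; simp [abs_of_pos h0]
      simp only [mem_ofPred_eq, add_sub_cancel_left, this]
      exact hr
  rw [this]
  apply IsPreconnected.image
  · exact (isPreconnected_iff_ordConnected.2 hs).prod isPreconnected_univ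
  · apply Continuous.continuousOn; fun_prop

/-- Two points of the complement of a compact set in different components: one of them lies
in a bounded component. -/
theorem bounded_or {K : Set ℂ} (hK : IsCompact K) {x y : ℂ} (h : ¬ Conn Kᶜ x y) :
    Bornology.IsBounded {z | Conn Kᶜ x z} ∨ Bornology.IsBounded {z | Conn Kᶜ y z} := by
  obtain ⟨R, hR⟩ := hK.isBounded.subset_ball 0
  have hout : IsPreconnected {z : ℂ | ‖z - 0‖ ∈ Ici (max R 1)} :=
    preconn_annulus 0 _ ordConnected_Ici (fun r hr => by
      have := le_max_right R 1
      simp only [mem_Ici] at hr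
      simp only [mem_Ioi]; linarith)
  have hsub : {z : ℂ | ‖z - 0‖ ∈ Ici (max R 1)} ⊆ Kᶜ := by
    intro z hz hzK
    have h1 := hR hzK
    simp at h1 hz
    linarith [hz.1]
  have key : ∀ w, ¬ Bornology.IsBounded {z | Conn Kᶜ w z} →
      ∃ z, Conn Kᶜ w z ∧ z ∈ {z : ℂ | ‖z - 0‖ ∈ Ici (max R 1)} := by
    intro w hw
    by_contra hcon
    push Not at hcon
    apply hw
    refine (Metric.isBounded_ball (x := (0:ℂ)) (r := max R 1)).subset (fun z hz => ?_)
    have := hcon z hz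
    simp only [mem_ofPred_eq, mem_Ici, not_le, sub_zero] at this
    simpa using this
  by_contra hcon
  push Not at hcon
  obtain ⟨z, hz1, hz2⟩ := key x hcon.1
  obtain ⟨w, hw1, hw2⟩ := key y hcon.2
  exact h (hz1.trans (Conn.trans ⟨_, hsub, hout, hz2, hw2⟩ hw1.symm))

end PF

open Set Topology

namespace PF

theorem log_arc {γ : unitInterval → ℂ} (hγ : Continuous γ) (hi : Function.Injective γ)
    (a b : unitInterval) (hab : a ≤ b) (G : ℂ → ℂ) (hG : ContinuousOn G (γ '' Icc a b))
    (h0 : ∀ z ∈ γ '' Icc a b, G z ≠ 0) :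
    ∃ M : ℂ → ℂ, ContinuousOn M (range γ) ∧ ∀ z ∈ γ '' Icc a b, Complex.exp (M z) = G z := by
  have hmem : ∀ t, γ (projIcc a b hab t) ∈ γ '' Icc a b := fun t =>
    mem_image_of_mem _ (projIcc a b hab t).2
  obtain ⟨L, hL, hLe⟩ := exists_log_I (fun t => G (γ (projIcc a b hab t)))
    (hG.comp_continuous (by
      exact hγ.comp (continuous_subtype_val.comp continuous_projIcc)) hmem) (fun t => h0 _ (hmem t))
  have hemb : IsClosedEmbedding γ := hγ.isClosedEmbedding hi
  refine ⟨Function.extend γ L 0, ?_, ?_⟩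
  · rw [continuousOn_iff_continuous_domRestrict]
    have : (range γ).domRestrict (Function.extend γ L 0) = L ∘ (hemb.isEmbedding.toHomeomorph).symm := by
      ext ⟨z, t, rfl⟩
      have h2 : (hemb.isEmbedding.toHomeomorph).symm ⟨γ t, t, rfl⟩ = t := by
        rw [Homeomorph.symm_apply_eq]; rfl
      simp only [Function.comp, h2]
      exact hi.extend_apply L 0 t
    rw [this]
    exact hL.comp (Homeomorph.continuous _)
  · rintro z ⟨t, ht, rfl⟩
    rw [hi.extend_apply, hLe, projIcc_of_mem hab ht]

theorem interior_arc {γ : unitInterval → ℂ} (hγ : Continuous γ) (hi : Function.Injective γ) :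
    interior (range γ) = ∅ := by
  by_contra hne
  obtain ⟨x, hx⟩ := nonempty_iff_ne_empty.2 hne
  obtain ⟨r, hr, hb⟩ := Metric.isOpen_iff.1 isOpen_interior x hx
  have hS : Metric.sphere x (r/2) ⊆ range γ := by
    refine Subset.trans (fun z hz => ?_) (hb.trans interior_subset)
    simp only [Metric.mem_sphere] at hz
    simp only [Metric.mem_ball]; linarith
  have hconn : IsConnected (γ ⁻¹' Metric.sphere x (r/2)) :=
    (isConnected_sphere rank_C x (by linarith)).preimage_of_isClosedMap hi
      (hγ.isClosedEmbedding hi).isClosedMap hS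
  have hcomp : IsCompact (γ ⁻¹' Metric.sphere x (r/2)) :=
    (Metric.isClosed_sphere.preimage hγ).isCompact
  have hIcc := eq_Icc_of_connected_compact hconn hcomp
  have hle : sInf (γ ⁻¹' Metric.sphere x (r/2)) ≤ sSup (γ ⁻¹' Metric.sphere x (r/2)) := by
    rw [← nonempty_Icc, ← hIcc]; exact hconn.nonempty
  have him : γ '' Icc (sInf (γ ⁻¹' Metric.sphere x (r/2))) (sSup (γ ⁻¹' Metric.sphere x (r/2)))
      = Metric.sphere x (r/2) := by
    rw [← hIcc, image_preimage_eq_of_subset hS]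
  obtain ⟨M, hM, hMe⟩ := log_arc hγ hi _ _ hle (fun z => z - x) (by fun_prop) (by
    rw [him]
    intro z hz h0
    rw [sub_eq_zero.1 h0] at hz
    simp at hz; linarith)
  rw [him] at hMe
  exact no_log_circle x (r/2) (by linarith) 1 one_ne_zero M (hM.mono hS) (fun z hz => by
    rw [hMe z hz, zpow_one])

theorem glue {K A : Set ℂ} (hK : IsClosed K) (hA : IsClosed A) {L M : ℂ → ℂ}
    (hL : ContinuousOn L K) (hM : ContinuousOn M A) (h : ∀ z ∈ A ∩ K, L z = M z) :
    ∃ N : ℂ → ℂ, ContinuousOn N (K ∪ A) ∧ (∀ z ∈ K, N z = L z) ∧ ∀ z ∈ A, N z = M z := by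
  classical
  have h1 : ∀ z ∈ K, (fun z => if z ∈ K then L z else M z) z = L z := fun z hz => if_pos hz
  have h2 : ∀ z ∈ A, (fun z => if z ∈ K then L z else M z) z = M z := by
    intro z hz
    by_cases hzK : z ∈ K
    · rw [h1 z hzK, h z ⟨hz, hzK⟩]
    · exact if_neg hzK
  exact ⟨fun z => if z ∈ K then L z else M z,
    ContinuousOn.union_of_isClosed (hL.congr h1) (hM.congr h2) hK hA, h1, h2⟩

theorem sep_contra {K : Set ℂ} (hK : IsCompact K) {n : ℕ} (x : Fin n → ℂ) (hx : ∀ i, x i ∉ K)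
    (hsep : ∀ i j, i ≠ j → ¬ Conn Kᶜ (x i) (x j)) (a : Fin n → ℤ) (i j : Fin n) (hij : i ≠ j)
    (hi : a i ≠ 0) (hj : a j ≠ 0) (N : ℂ → ℂ) (hN : ContinuousOn N K)
    (hNe : ∀ z ∈ K, Complex.exp (N z) = ∏ i, (z - x i) ^ a i) : False := by
  have key : ∀ i, a i ≠ 0 → Bornology.IsBounded {y | Conn Kᶜ (x i) y} → False := by
    intro i hi hb
    have hne : ∀ z ∈ K ∪ {y | Conn Kᶜ (x i) y}, ∀ j ∈ Finset.univ.erase i, z - x j ≠ 0 := by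
      intro z hz j hj h0
      rw [sub_eq_zero.1 h0] at hz
      rcases hz with hz | hz
      · exact hx j hz
      · exact hsep i j (Finset.ne_of_mem_erase hj).symm hz
    refine no_log_bounded hK (hx i) hb (a i) hi
      (fun z => ∏ j ∈ Finset.univ.erase i, (z - x j) ^ a j) ?_ ?_ N hN ?_
    · apply continuousOn_finsetProd
      intro j hj
      apply ContinuousOn.zpow₀ (by fun_prop)
      intro z hz
      exact Or.inl (hne z hz j hj)
    · intro z hz
      exact Finset.prod_ne_zero_iff.2 (fun j hj => zpow_ne_zero _ (hne z hz j hj))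
    · intro z hz
      rw [hNe z hz, Finset.mul_prod_erase Finset.univ (fun i => (z - x i) ^ a i) (Finset.mem_univ i)]
  rcases bounded_or hK (hsep i j hij) with h | h
  · exact key i hi h
  · exact key j hj h

/-- A dangling arc does not separate. -/
theorem le_one {K : Set ℂ} (hK : IsCompact K) {γ : unitInterval → ℂ} (hγ : Continuous γ)
    (hi : Function.Injective γ) (p : ℂ) (hp : range γ ∩ K ⊆ {p}) {x y : ℂ}
    (hx : x ∉ K ∪ range γ) (hy : y ∉ K ∪ range γ) (hxy : Conn Kᶜ x y) :
    Conn (K ∪ range γ)ᶜ x y := by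
  by_contra hcon
  have hA : IsCompact (range γ) := isCompact_range hγ
  obtain ⟨L, hL, hLe⟩ := log_of_conn hK hxy
  have hyA : ∀ z ∈ range γ, z - y ≠ 0 := by
    intro z hz h0; rw [sub_eq_zero.1 h0] at hz; exact hy (Or.inr hz)
  have hxA : ∀ z ∈ range γ, z - x ≠ 0 := by
    intro z hz h0; rw [sub_eq_zero.1 h0] at hz; exact hx (Or.inr hz)
  have hyK : ∀ z ∈ K, z - y ≠ 0 := by
    intro z hz h0; rw [sub_eq_zero.1 h0] at hz; exact hy (Or.inl hz)
  have hIcc : γ '' Icc 0 1 = range γ := by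
    rw [← image_univ]; congr 1; ext t; simpa using unitInterval.le_one'
  obtain ⟨M, hM, hMe⟩ := log_arc hγ hi 0 1 zero_le_one (fun z => (z - x) / (z - y))
    (by rw [hIcc]; exact ContinuousOn.div (by fun_prop) (by fun_prop) hyA)
    (by rw [hIcc]; exact fun z hz => div_ne_zero (hxA z hz) (hyA z hz))
  rw [hIcc] at hMe
  have hex : ∃ c : ℂ, Complex.exp c = 1 ∧ ∀ z ∈ range γ ∩ K, L z = M z + c := by
    by_cases hpp : p ∈ range γ ∩ K
    · refine ⟨L p - M p, ?_, ?_⟩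
      · rw [Complex.exp_sub, hMe p hpp.1, ← hLe p hpp.2, mul_div_cancel_right₀ _ (hyK p hpp.2)]
        exact div_self (Complex.exp_ne_zero _)
      · intro z hz
        have := hp hz
        rw [mem_singleton_iff] at this
        subst this; ring
    · refine ⟨0, Complex.exp_zero, fun z hz => ?_⟩
      have := hp hz
      rw [mem_singleton_iff] at this
      subst this; exact absurd hz hpp
  obtain ⟨c, hc, hcz⟩ := hex
  obtain ⟨N, hN, hNK, hNA⟩ := glue hK.isClosed hA.isClosed hL (hM.add continuousOn_const) hcz
  refine sep_contra (hK.union hA) ![x, y] ?_ ?_ ![1, -1] 0 1 (by simp) (by simp) (by simp) N hN ?_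
  · intro i; fin_cases i
    · exact hx
    · exact hy
  · intro i j hij; fin_cases i <;> fin_cases j
    · exact absurd rfl hij
    · exact hcon
    · exact fun h => hcon h.symm
    · exact absurd rfl hij
  · intro z hz
    simp only [Fin.prod_univ_two, Matrix.cons_val_zero, Matrix.cons_val_one, zpow_one, zpow_neg]
    rcases hz with hz | hz
    · rw [hNK z hz, ← hLe z hz, mul_assoc, mul_inv_cancel₀ (hyK z hz), mul_one]
    · rw [hNA z hz]; show Complex.exp (M z + c) = _; rw [Complex.exp_add, hc, hMe z hz, mul_one, div_eq_mul_inv]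

/-- An arc splits a region into at most two pieces. -/
theorem le_two {K : Set ℂ} (hK : IsCompact K) {γ : unitInterval → ℂ} (hγ : Continuous γ)
    (hi : Function.Injective γ) (h0K : γ 0 ∈ K) (h1K : γ 1 ∈ K)
    (hp : range γ ∩ K ⊆ {γ 0, γ 1}) (x : Fin 3 → ℂ)
    (hx : ∀ i, x i ∉ K ∪ range γ) (hxy : ∀ i j, Conn Kᶜ (x i) (x j)) :
    ∃ i j, i ≠ j ∧ Conn (K ∪ range γ)ᶜ (x i) (x j) := by
  by_contra hcon
  push Not at hcon
  have hA : IsCompact (range γ) := isCompact_range hγ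
  have hneA : ∀ i, ∀ z ∈ range γ, z - x i ≠ 0 := by
    intro i z hz h0; rw [sub_eq_zero.1 h0] at hz; exact hx i (Or.inr hz)
  have hneK : ∀ i, ∀ z ∈ K, z - x i ≠ 0 := by
    intro i z hz h0; rw [sub_eq_zero.1 h0] at hz; exact hx i (Or.inl hz)
  have hIcc : γ '' Icc 0 1 = range γ := by
    rw [← image_univ]; congr 1; ext t; simpa using unitInterval.le_one'
  -- data for index `i`
  have data : ∀ i, ∃ L M : ℂ → ℂ, ContinuousOn L K ∧ ContinuousOn M (range γ) ∧
      (∀ z ∈ K, Complex.exp (L z) = (z - x i) / (z - x 2)) ∧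
      (∀ z ∈ range γ, Complex.exp (M z) = (z - x i) / (z - x 2)) ∧
      ∃ d e : ℤ, L (γ 0) - M (γ 0) = d * (2 * Real.pi * Complex.I) ∧
        L (γ 1) - M (γ 1) = e * (2 * Real.pi * Complex.I) := by
    intro i
    obtain ⟨L, hL, hLe⟩ := log_of_conn hK (hxy i 2)
    have hLe' : ∀ z ∈ K, Complex.exp (L z) = (z - x i) / (z - x 2) := by
      intro z hz
      rw [← hLe z hz, mul_div_cancel_right₀ _ (hneK 2 z hz)]
    obtain ⟨M, hM, hMe⟩ := log_arc hγ hi 0 1 zero_le_one (fun z => (z - x i) / (z - x 2))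
      (by rw [hIcc]; exact ContinuousOn.div (by fun_prop) (by fun_prop) (hneA 2))
      (by rw [hIcc]; exact fun z hz => div_ne_zero (hneA i z hz) (hneA 2 z hz))
    rw [hIcc] at hMe
    have hintr : ∀ z ∈ K, z ∈ range γ → ∃ d : ℤ, L z - M z = d * (2 * Real.pi * Complex.I) := by
      intro z hz hz'
      apply Complex.exp_eq_one_iff.1
      rw [Complex.exp_sub, hLe' z hz, hMe z hz']
      exact div_self (div_ne_zero (hneA i z hz') (hneA 2 z hz'))
    obtain ⟨d, hd⟩ := hintr _ h0K ⟨0, rfl⟩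
    obtain ⟨e, he⟩ := hintr _ h1K ⟨1, rfl⟩
    exact ⟨L, M, hL, hM, hLe', hMe, d, e, hd, he⟩
  obtain ⟨L, M, hL, hM, hLe, hMe, d, e, hd, he⟩ := data 0
  obtain ⟨L', M', hL', hM', hLe', hMe', d', e', hd', he'⟩ := data 1
  obtain ⟨a, b, hab, hab0⟩ : ∃ a b : ℤ, a * (e - d) + b * (e' - d') = 0 ∧ (a ≠ 0 ∨ b ≠ 0) := by
    by_cases h : e' - d' = 0
    · by_cases h2 : e - d = 0
      · exact ⟨1, 0, by simp [h2], Or.inl one_ne_zero⟩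
      · exact ⟨0, 1, by simp [h], Or.inr one_ne_zero⟩
    · exact ⟨e' - d', -(e - d), by ring, Or.inl h⟩
  let c : ℂ := (a * d + b * d') * (2 * Real.pi * Complex.I)
  have hc : Complex.exp c = 1 := by
    apply Complex.exp_eq_one_iff.2
    exact ⟨a * d + b * d', by simp [c]⟩
  have habC : (a : ℂ) * (e - d) + b * (e' - d') = 0 := by exact_mod_cast hab
  obtain ⟨N, hN, hNK, hNA⟩ := glue (L := fun z => a * L z + b * L' z)
    (M := fun z => a * M z + b * M' z + c) hK.isClosed hA.isClosed
    (by fun_prop) (by fun_prop) (by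
      intro z hz
      rcases hp hz with h | h
      · rw [h]; simp only [c]; linear_combination a * hd + b * hd'
      · rw [mem_singleton_iff] at h
        rw [h]; simp only [c]
        linear_combination a * he + b * he' + (2 * Real.pi * Complex.I) * habC)
  have hpow : ∀ (u v w : ℂ), w ≠ 0 →
      (u / w) ^ a * (v / w) ^ b = u ^ a * v ^ b * w ^ (-a - b) := by
    intro u v w hw
    rw [div_zpow, div_zpow, zpow_sub₀ hw, zpow_neg]
    field_simp
  obtain ⟨i, j, hij, hi0, hj0⟩ : ∃ i j : Fin 3, i ≠ j ∧ (![a, b, -a-b] : Fin 3 → ℤ) i ≠ 0 ∧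
      (![a, b, -a-b] : Fin 3 → ℤ) j ≠ 0 := by
    by_cases ha : a = 0
    · refine ⟨1, 2, by simp, ?_, ?_⟩ <;> simp <;> omega
    · by_cases hb : b = 0
      · refine ⟨0, 2, by simp, ?_, ?_⟩ <;> simp <;> omega
      · exact ⟨0, 1, by simp, by simpa using ha, by simpa using hb⟩
  refine sep_contra (hK.union hA) x hx hcon ![a, b, -a-b] i j hij hi0 hj0 N hN ?_
  intro z hz
  simp only [Fin.prod_univ_three, Matrix.cons_val_zero, Matrix.cons_val_one, Matrix.cons_val]
  have hz2 : z - x 2 ≠ 0 := by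
    rcases hz with hz | hz
    · exact hneK 2 z hz
    · exact hneA 2 z hz
  rw [← hpow _ _ _ hz2]
  rcases hz with hz | hz
  · rw [hNK z hz, Complex.exp_add, Complex.exp_int_mul, Complex.exp_int_mul, hLe z hz, hLe' z hz]
  · rw [hNA z hz, Complex.exp_add, Complex.exp_add, hc, mul_one, Complex.exp_int_mul,
      Complex.exp_int_mul, hMe z hz, hMe' z hz]

/-- Logarithm of `(z - σ 0)/(z - σ 1)` off a path `σ`. -/
theorem log_off_path {σ : unitInterval → ℂ} (hσ : Continuous σ) :
    ∃ l : ℂ → ℂ, ContinuousOn l (range σ)ᶜ ∧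
      ∀ z ∈ (range σ)ᶜ, Complex.exp (l z) * (z - σ 1) = z - σ 0 := by
  have hne : ∀ z ∈ (range σ)ᶜ, ∀ t, z - σ t ≠ 0 := by
    intro z hz t h0
    exact hz ⟨t, (sub_eq_zero.1 h0).symm⟩
  have hex : ∀ z : ℂ, ∃ L : unitInterval → ℂ, z ∈ (range σ)ᶜ →
      Continuous L ∧ ∀ t, Complex.exp (L t) = z - σ t := by
    intro z
    by_cases hz : z ∈ (range σ)ᶜ
    · obtain ⟨L, h1, h2⟩ := exists_log_I (fun t => z - σ t) (by fun_prop) (hne z hz)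
      exact ⟨L, fun _ => ⟨h1, h2⟩⟩
    · exact ⟨0, fun h => absurd h hz⟩
  choose L hLL using hex
  have hcl : IsOpen (range σ)ᶜ := (isCompact_range hσ).isClosed.isOpen_compl
  refine ⟨fun z => L z 0 - L z 1, ?_, ?_⟩
  · intro z₀ hz₀
    apply ContinuousAt.continuousWithinAt
    obtain ⟨ε, hε, hb⟩ := Metric.isOpen_iff.1 hcl z₀ hz₀
    have hslit : ∀ z ∈ Metric.ball z₀ ε, ∀ t, (z - σ t) / (z₀ - σ t) ∈ Complex.slitPlane := by
      intro z hz t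
      have h1 : ε ≤ ‖z₀ - σ t‖ := by
        by_contra hcon
        push Not at hcon
        exact hb (show σ t ∈ Metric.ball z₀ ε by
          rw [Metric.mem_ball, dist_comm, dist_eq_norm]; exact hcon) ⟨t, rfl⟩
      have h0 := hne z₀ hz₀ t
      have h2 : (z - σ t) / (z₀ - σ t) = 1 + (z - z₀) / (z₀ - σ t) := by
        field_simp; ring
      rw [h2]
      apply Complex.mem_slitPlane_of_norm_lt_one
      rw [norm_div, div_lt_one (by linarith)]
      have : ‖z - z₀‖ < ε := by rw [← dist_eq_norm]; exact hz
      linarith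
    have hev : (fun z => (L z₀ 0 - L z₀ 1) + (Complex.log ((z - σ 0) / (z₀ - σ 0)) -
        Complex.log ((z - σ 1) / (z₀ - σ 1)))) =ᶠ[𝓝 z₀] (fun z => L z 0 - L z 1) := by
      filter_upwards [Metric.ball_mem_nhds z₀ hε] with z hz
      have hzc := hb hz
      obtain ⟨hc, he⟩ := hLL z hzc
      obtain ⟨hc0, he0⟩ := hLL z₀ hz₀
      have hcont : Continuous (fun t => L z t - L z₀ t - Complex.log ((z - σ t) / (z₀ - σ t))) := by
        refine (hc.sub hc0).sub ?_
        refine Continuous.clog ?_ (hslit z hz)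
        exact Continuous.div (by fun_prop) (by fun_prop) (hne z₀ hz₀)
      have := const_of_exp (x := (0 : unitInterval)) (y := 1) isPreconnected_univ
        hcont.continuousOn 1 (fun t _ => by
          rw [Complex.exp_sub, Complex.exp_sub, he, he0,
            Complex.exp_log (Complex.slitPlane_ne_zero (hslit z hz t))]
          exact div_self (Complex.slitPlane_ne_zero (hslit z hz t))) (mem_univ _) (mem_univ _)
      linear_combination -this
    refine ContinuousAt.congr ?_ hev
    refine continuousAt_const.add (ContinuousAt.sub ?_ ?_)
    · refine ContinuousAt.clog ?_ (hslit z₀ (Metric.mem_ball_self hε) 0)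
      exact ContinuousAt.div (by fun_prop) (by fun_prop) (hne z₀ hz₀ 0)
    · refine ContinuousAt.clog ?_ (hslit z₀ (Metric.mem_ball_self hε) 1)
      exact ContinuousAt.div (by fun_prop) (by fun_prop) (hne z₀ hz₀ 1)
  · intro z hz
    obtain ⟨-, he⟩ := hLL z hz
    rw [Complex.exp_sub, he, he, div_mul_cancel₀ _ (hne z hz 1)]

theorem no_log_two_points (p q : ℂ) (hpq : p ≠ q) (l : ℂ → ℂ) (hl : ContinuousOn l {p, q}ᶜ)
    (h : ∀ z ∈ ({p, q} : Set ℂ)ᶜ, Complex.exp (l z) * (z - q) = z - p) : False := by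
  have hd : 0 < ‖p - q‖ := norm_pos_iff.2 (sub_ne_zero.2 hpq)
  have hpq0 : p - q ≠ 0 := sub_ne_zero.2 hpq
  set r := ‖p - q‖ / 2 with hr
  have hslit : ∀ z ∈ Metric.sphere p r, (z - q) / (p - q) ∈ Complex.slitPlane := by
    intro z hz
    have h2 : (z - q) / (p - q) = 1 + (z - p) / (p - q) := by
      field_simp; ring
    rw [h2]
    apply Complex.mem_slitPlane_of_norm_lt_one
    rw [norm_div, div_lt_one hd]
    have : ‖z - p‖ = r := by rw [← dist_eq_norm]; exact hz
    linarith
  have hsub : Metric.sphere p r ⊆ {p, q}ᶜ := by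
    intro z hz hz'
    rcases hz' with rfl | hz'
    · simp at hz; linarith
    · rw [mem_singleton_iff] at hz'
      subst hz'
      have := hslit z hz
      rw [sub_self, zero_div] at this
      exact Complex.slitPlane_ne_zero this rfl
  refine no_log_circle p r (by linarith) 1 one_ne_zero
    (fun z => l z + Complex.log ((z - q) / (p - q)) + Complex.log (p - q)) ?_ ?_
  · refine ((hl.mono hsub).add (ContinuousOn.clog ?_ hslit)).add continuousOn_const
    exact ContinuousOn.div (by fun_prop) (by fun_prop) (fun _ _ => hpq0)
  · intro z hz
    rw [Complex.exp_add, Complex.exp_add, Complex.exp_log hpq0,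
      Complex.exp_log (Complex.slitPlane_ne_zero (hslit z hz)), mul_assoc,
      div_mul_cancel₀ _ hpq0, h z (hsub hz), zpow_one]

/-- An arc joining two points that are joined in `K` separates its region. -/
theorem ge_two {K : Set ℂ} (hK : IsClosed K) {γ : unitInterval → ℂ} (hγ : Continuous γ)
    (hi : Function.Injective γ) (hp : range γ ∩ K ⊆ {γ 0, γ 1}) (hj : JoinedIn K (γ 0) (γ 1))
    (m : ℂ) (hm : ∀ t, t ≠ 0 → t ≠ 1 → Conn Kᶜ m (γ t)) :
    ∃ x y, x ∉ K ∪ range γ ∧ y ∉ K ∪ range γ ∧ Conn Kᶜ m x ∧ Conn Kᶜ m y ∧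
      ¬ Conn (K ∪ range γ)ᶜ x y := by
  by_contra hcon
  push Not at hcon
  obtain ⟨σ, hσ⟩ := hj
  obtain ⟨l₁, hl₁, hl₁e⟩ := log_off_path σ.continuous
  obtain ⟨l₂, hl₂, hl₂e⟩ := log_off_path hγ
  simp only [σ.source, σ.target] at hl₁e
  have hsubK : range σ ⊆ K := by rintro _ ⟨t, rfl⟩; exact hσ t
  have hKσ : Kᶜ ⊆ (range σ)ᶜ := compl_subset_compl.2 hsubK
  have h1K : γ 1 ∈ K := by rw [← σ.target]; exact hσ 1
  have h0K : γ 0 ∈ K := by rw [← σ.source]; exact hσ 0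
  set W := {z | Conn Kᶜ m z} with hW
  have hWo : IsOpen W := isOpen_conn hK.isOpen_compl m
  have hWK : W ⊆ Kᶜ := fun z hz => Conn.right hz
  have hAo : IsOpen (range γ)ᶜ := (isCompact_range hγ).isClosed.isOpen_compl
  have hexp : ∀ z ∈ (K ∪ range γ)ᶜ, Complex.exp (l₁ z - l₂ z) = 1 := by
    intro z hz
    rw [compl_union] at hz
    have hq : z - γ 1 ≠ 0 := fun h0 => hz.2 ⟨1, (sub_eq_zero.1 h0).symm⟩
    have e1 := hl₁e z (hKσ hz.1)
    have e2 := hl₂e z hz.2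
    rw [Complex.exp_sub, div_eq_one_iff_eq (Complex.exp_ne_zero _)]
    exact mul_right_cancel₀ hq (e1.trans e2.symm)
  obtain ⟨k, hk1, hk⟩ : ∃ k : ℂ, Complex.exp k = 1 ∧
      ∀ z ∈ W, z ∉ range γ → l₁ z = l₂ z + k := by
    by_cases hne : ∃ z ∈ W, z ∉ range γ
    · obtain ⟨z, hz, hz'⟩ := hne
      have hz'' : z ∉ K ∪ range γ := fun h => h.elim (hWK hz) hz'
      refine ⟨l₁ z - l₂ z, hexp z hz'', fun w hw hw' => ?_⟩
      obtain ⟨t, ht, hc, hwt, hzt⟩ := hcon w z (fun h => h.elim (hWK hw) hw') hz'' hw hz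
      have ht' := ht
      rw [compl_union] at ht'
      have := const_of_exp (f := fun z => l₁ z - l₂ z) hc
        ((hl₁.mono ((ht'.trans inter_subset_left).trans hKσ)).sub
          (hl₂.mono (ht'.trans inter_subset_right))) 1 (fun a ha => hexp a (ht ha)) hwt hzt
      linear_combination this
    · push Not at hne
      exact ⟨0, Complex.exp_zero, fun z hz hz' => absurd (hne z hz) hz'⟩
  classical
  let l : ℂ → ℂ := fun z => if z ∈ W then l₁ z else l₂ z + k
  have hlW : ∀ z ∈ W, l z = l₁ z := fun z hz => if_pos hz
  have hlA : ∀ z ∈ (range γ)ᶜ, l z = l₂ z + k := by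
    intro z hz
    by_cases hzW : z ∈ W
    · rw [hlW z hzW, hk z hzW hz]
    · exact if_neg hzW
  have hcover : ∀ z ∈ ({γ 0, γ 1} : Set ℂ)ᶜ, z ∈ W ∨ z ∈ (range γ)ᶜ := by
    intro z hz
    by_cases h : z ∈ range γ
    · obtain ⟨t, rfl⟩ := h
      left
      apply hm
      · rintro rfl; exact hz (Or.inl rfl)
      · rintro rfl; exact hz (Or.inr rfl)
    · exact Or.inr h
  refine no_log_two_points (γ 0) (γ 1) (hi.ne zero_ne_one) l ?_ ?_
  · intro z hz
    apply ContinuousAt.continuousWithinAt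
    rcases hcover z hz with h | h
    · exact ((hl₁.mono (hWK.trans hKσ)).congr hlW).continuousAt (hWo.mem_nhds h)
    · exact ((hl₂.add continuousOn_const).congr hlA).continuousAt (hAo.mem_nhds h)
  · intro z hz
    rcases hcover z hz with h | h
    · rw [hlW z h]; exact hl₁e z (hKσ (hWK h))
    · rw [hlA z h, Complex.exp_add, hk1, mul_one]; exact hl₂e z h

end PF

open Set Topology

namespace PF

/-- A drawing of an abstract multigraph in `ℂ`. -/
structure CEmb (V E : Type) where
  pt : V → ℂ
  pt_inj : Function.Injective pt
  γ : E → unitInterval → ℂ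
  cont : ∀ e, Continuous (γ e)
  inj : ∀ e, Function.Injective (γ e)
  src : E → V
  tgt : E → V
  γ0 : ∀ e, γ e 0 = pt (src e)
  γ1 : ∀ e, γ e 1 = pt (tgt e)
  inter : ∀ e e', e ≠ e' → range (γ e) ∩ range (γ e') ⊆ range pt
  pt_mem : ∀ e x, pt x ∈ range (γ e) → x = src e ∨ x = tgt e

namespace CEmb

variable {V E : Type} (M : CEmb V E)

def K (C : Set E) : Set ℂ := (⋃ e ∈ C, range (M.γ e)) ∪ range M.pt

noncomputable def half : unitInterval := ⟨1 / 2, by norm_num, by norm_num⟩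

noncomputable def m (e : E) : ℂ := M.γ e half

/-- incident edges -/
def D (v : V) : Set E := {e | M.src e = v ∨ M.tgt e = v}

def W : Set ℂ := (M.K univ)ᶜ

def At (e : E) (x : ℂ) : Prop := Conn (M.K {e}ᶜ)ᶜ x (M.m e)

theorem half0 : half ≠ 0 := by
  intro h; have := congrArg Subtype.val h; norm_num [half] at this

theorem half1 : half ≠ 1 := by
  intro h; have := congrArg Subtype.val h; norm_num [half] at this

theorem K_mono {C C' : Set E} (h : C ⊆ C') : M.K C ⊆ M.K C' :=
  union_subset_union_left _ (biUnion_subset_biUnion_left h)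

theorem Kc_mono {C C' : Set E} (h : C ⊆ C') : (M.K C')ᶜ ⊆ (M.K C)ᶜ :=
  compl_subset_compl.2 (M.K_mono h)

theorem W_sub (C : Set E) : M.W ⊆ (M.K C)ᶜ := M.Kc_mono (subset_univ C)

theorem K_insert (e : E) (C : Set E) : M.K (insert e C) = M.K C ∪ range (M.γ e) := by
  unfold K
  rw [biUnion_insert, union_comm (range _), union_right_comm]

theorem pt_mem_K (C : Set E) (v : V) : M.pt v ∈ M.K C := Or.inr ⟨v, rfl⟩

theorem not_end {e : E} {t : unitInterval} (h0 : t ≠ 0) (h1 : t ≠ 1) : M.γ e t ∉ range M.pt := by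
  rintro ⟨x, hx⟩
  rcases M.pt_mem e x ⟨t, hx.symm⟩ with h | h
  · rw [h, ← M.γ0] at hx; exact h0 (M.inj e hx).symm
  · rw [h, ← M.γ1] at hx; exact h1 (M.inj e hx).symm

theorem int_notMem {e : E} {C : Set E} (he : e ∉ C) {t : unitInterval} (h0 : t ≠ 0) (h1 : t ≠ 1) :
    M.γ e t ∉ M.K C := by
  rintro (h | h)
  · simp only [mem_iUnion] at h
    obtain ⟨e', he', h⟩ := h
    have hne : e ≠ e' := fun h => he (h ▸ he')
    exact M.not_end h0 h1 (M.inter e e' hne ⟨⟨t, rfl⟩, h⟩)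
  · exact M.not_end h0 h1 h

theorem arc_inter_K {e : E} {C : Set E} (he : e ∉ C) :
    range (M.γ e) ∩ M.K C ⊆ {M.γ e 0, M.γ e 1} := by
  rintro z ⟨⟨t, rfl⟩, hz⟩
  by_cases h0 : t = 0
  · left; rw [h0]
  by_cases h1 : t = 1
  · right; rw [h1]; rfl
  exact absurd hz (M.int_notMem he h0 h1)

theorem src_mem_K (e : E) (C : Set E) : M.γ e 0 ∈ M.K C := by rw [M.γ0]; exact M.pt_mem_K C _

theorem tgt_mem_K (e : E) (C : Set E) : M.γ e 1 ∈ M.K C := by rw [M.γ1]; exact M.pt_mem_K C _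

theorem int_conn {e : E} {C : Set E} (he : e ∉ C) {t : unitInterval} (h0 : t ≠ 0) (h1 : t ≠ 1) :
    Conn (M.K C)ᶜ (M.m e) (M.γ e t) := by
  refine ⟨M.γ e '' Ioo 0 1, ?_, ?_, ?_, ?_⟩
  · rintro _ ⟨s, hs, rfl⟩
    exact M.int_notMem he hs.1.ne' hs.2.ne
  · exact isPreconnected_Ioo.image _ (M.cont e).continuousOn
  · exact ⟨half, ⟨bot_lt_iff_ne_bot.2 half0, lt_top_iff_ne_top.2 half1⟩, rfl⟩
  · exact ⟨t, ⟨bot_lt_iff_ne_bot.2 h0, lt_top_iff_ne_top.2 h1⟩, rfl⟩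

theorem m_mem {e : E} {C : Set E} (he : e ∉ C) : M.m e ∈ (M.K C)ᶜ := M.int_notMem he half0 half1

theorem mem_conn {e : E} {C : Set E} (he : e ∉ C) {z : ℂ} (hz : z ∈ range (M.γ e))
    (hC : z ∉ M.K C) : Conn (M.K C)ᶜ z (M.m e) := by
  obtain ⟨t, rfl⟩ := hz
  refine (M.int_conn he ?_ ?_).symm
  · rintro rfl; exact hC (M.src_mem_K e C)
  · rintro rfl; exact hC (M.tgt_mem_K e C)

theorem merge {e : E} {C : Set E} (he : e ∉ C) {x y : ℂ}
    (h : Conn (M.K C)ᶜ x y) (hn : ¬ Conn (M.K (insert e C))ᶜ x y) :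
    Conn (M.K C)ᶜ x (M.m e) := by
  obtain ⟨t, ht, hc, hx, hy⟩ := h
  by_cases hd : ∃ z ∈ t, z ∈ range (M.γ e)
  · obtain ⟨z, hz, hz'⟩ := hd
    exact Conn.trans ⟨t, ht, hc, hx, hz⟩ (M.mem_conn he hz' (ht hz))
  · push Not at hd
    refine absurd ⟨t, ?_, hc, hx, hy⟩ hn
    intro z hz
    rw [K_insert]
    exact fun h => h.elim (ht hz) (hd z hz)

theorem At.of_conn {e : E} {x y : ℂ} (h : M.At e y) (hxy : Conn M.W x y) : M.At e x :=
  (hxy.mono (M.W_sub _)).trans h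

theorem At.conn {e : E} {x : ℂ} (h : M.At e x) {D : Set E} (he : e ∈ D) :
    Conn (M.K Dᶜ)ᶜ x (M.m e) :=
  Conn.mono h (M.Kc_mono (compl_subset_compl.2 (by simpa using he)))

variable [Finite V] [Finite E]

theorem K_compact (C : Set E) : IsCompact (M.K C) :=
  ((toFinite C).isCompact_biUnion fun e _ => isCompact_range (M.cont e)).union
    (finite_range _).isCompact

theorem Kc_open (C : Set E) : IsOpen (M.K C)ᶜ := (M.K_compact C).isClosed.isOpen_compl

theorem dense_W : Dense M.W := by
  have : M.W = (⋂ e, (range (M.γ e))ᶜ) ∩ ⋂ v, {M.pt v}ᶜ := by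
    unfold W K
    ext z; simp [eq_comm]
  rw [this]
  have h1 : Dense (⋂ e, (range (M.γ e))ᶜ) := by
    refine dense_iInter_of_isOpen (fun e => (isCompact_range (M.cont e)).isClosed.isOpen_compl)
      fun e => ?_
    rw [← interior_eq_empty_iff_dense_compl]
    exact interior_arc (M.cont e) (M.inj e)
  refine h1.inter_of_isOpen_right ?_ ?_
  · refine dense_iInter_of_isOpen (fun v => isOpen_compl_singleton) fun v => dense_compl_singleton _
  · exact isOpen_iInter_of_finite fun v => isOpen_compl_singleton

theorem exists_W {U : Set ℂ} (hU : IsOpen U) (hne : U.Nonempty) : ∃ z ∈ U, z ∈ M.W :=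
  M.dense_W.inter_open_nonempty U hU hne

/-- perturb a point into `W` staying in the same component. -/
theorem perturb {C : Set E} {x : ℂ} (hx : x ∈ (M.K C)ᶜ) : ∃ z ∈ M.W, Conn (M.K C)ᶜ x z := by
  obtain ⟨z, h1, h2⟩ := M.exists_W (U := {z | Conn (M.K C)ᶜ x z}) (isOpen_conn (M.Kc_open C) x)
    ⟨x, Conn.refl hx⟩
  exact ⟨z, h2, h1⟩

theorem exists_At (e : E) : ∃ z ∈ M.W, M.At e z := by
  obtain ⟨z, h1, h2⟩ := M.perturb (C := {e}ᶜ) (M.m_mem (e := e) (by simp))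
  exact ⟨z, h1, h2.symm⟩

theorem reach {e : E} {D' : Set E} {x : ℂ} (hx : x ∈ M.W)
    (h : Conn (M.K (insert e D')ᶜ)ᶜ x (M.m e)) :
    ∃ x' ∈ M.W, M.At e x' ∧ Conn (M.K D'ᶜ)ᶜ x x' := by
  set X := {z | Conn (M.K D'ᶜ)ᶜ x z} with hX
  have hXo : IsOpen X := isOpen_conn (M.Kc_open _) x
  have hxX : x ∈ X := Conn.refl (M.W_sub _ hx)
  have key : ∃ p ∈ closure X, p ∈ range (M.γ e) ∧ p ∉ M.K {e}ᶜ := by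
    by_contra hcon
    push Not at hcon
    obtain ⟨t, ht, hc, hxt, hmt⟩ := h
    have hsub : t ⊆ X ∪ (closure X)ᶜ := by
      intro z hz
      by_cases hzX : z ∈ closure X
      · left
        have hzz : z ∈ (M.K D'ᶜ)ᶜ := by
          intro hzK
          have hz2 : z ∈ M.K (insert e (insert e D')ᶜ) := by
            refine M.K_mono ?_ hzK
            intro a ha
            by_cases hae : a = e
            · left; exact hae
            · right; intro hh; exact hh.elim hae ha
          rw [K_insert] at hz2
          have hz3 : z ∈ range (M.γ e) := hz2.resolve_left (ht hz)
          have hz4 := hcon z hzX hz3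
          obtain ⟨s, rfl⟩ := hz3
          refine M.int_notMem (e := e) (C := {e}ᶜ) (by simp) (t := s) ?_ ?_ hz4
          · rintro rfl; exact ht hz (M.src_mem_K e _)
          · rintro rfl; exact ht hz (M.tgt_mem_K e _)
        obtain ⟨w, hw1, hw2⟩ := mem_closure_iff.1 hzX {w | Conn (M.K D'ᶜ)ᶜ z w}
          (isOpen_conn (M.Kc_open _) z) (Conn.refl hzz)
        exact Conn.trans hw2 (Conn.symm hw1)
      · right; exact hzX
    have hm : M.m e ∈ (closure X)ᶜ := fun hm =>
      M.m_mem (e := e) (C := {e}ᶜ) (by simp) (hcon _ hm ⟨half, rfl⟩)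
    obtain ⟨z, hz, hz1, hz2⟩ := hc X (closure X)ᶜ hXo isClosed_closure.isOpen_compl hsub
      ⟨x, hxt, hxX⟩ ⟨_, hmt, hm⟩
    exact hz2 (subset_closure hz1)
  obtain ⟨p, hp, hpe, hpK⟩ := key
  have hO : IsOpen {w | Conn (M.K {e}ᶜ)ᶜ p w} := isOpen_conn (M.Kc_open _) p
  obtain ⟨w, hw⟩ := mem_closure_iff.1 hp _ hO (Conn.refl hpK)
  obtain ⟨x', ⟨h1, h2⟩, h3⟩ := M.exists_W (hO.inter hXo) ⟨w, hw⟩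
  exact ⟨x', h3, (Conn.symm h1).trans (M.mem_conn (by simp) hpe hpK), h2⟩

theorem chain (Q : ℂ → Prop) (hQ : ∀ a b, Conn M.W a b → Q a → Q b) (D : Set E)
    (hD : ∀ e ∈ D, ∀ a ∈ M.W, ∀ b ∈ M.W, M.At e a → M.At e b → Q a → Q b) :
    ∀ x ∈ M.W, ∀ y ∈ M.W, Conn (M.K Dᶜ)ᶜ x y → Q x → Q y := by
  have hfin : D.Finite := toFinite D
  induction D, hfin using Set.Finite.induction_on with
  | empty =>
    intro x _ y _ h
    rw [compl_empty] at h
    exact hQ x y h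
  | @insert e D' he _ ih =>
    have ih := ih (fun e' he' => hD e' (mem_insert_of_mem _ he'))
    intro x hx y hy h hq
    have heq : insert e (insert e D')ᶜ = D'ᶜ := by
      ext a; simp only [mem_insert_iff, mem_compl_iff, not_or]
      constructor
      · rintro (rfl | h); exacts [he, h.2]
      · intro ha
        by_cases hae : a = e
        · left; exact hae
        · right; exact ⟨hae, ha⟩
    have hne : e ∉ (insert e D')ᶜ := by simp
    by_cases hc : Conn (M.K D'ᶜ)ᶜ x y
    · exact ih x hx y hy hc hq
    · have h1 := M.merge hne h (by rwa [heq])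
      have h2 := M.merge hne h.symm (by rw [heq]; exact fun h => hc h.symm)
      obtain ⟨x', hx', hAx, hxx⟩ := M.reach hx h1
      obtain ⟨y', hy', hAy, hyy⟩ := M.reach hy h2
      exact ih y' hy' y hy hyy.symm (hD e (mem_insert _ _) x' hx' y' hy' hAx hAy
        (ih x hx x' hx' hxx hq))

theorem exists_at {D : Set E} {x : ℂ} (hx : x ∈ M.W) {e : E} (he : e ∈ D)
    (h : Conn (M.K Dᶜ)ᶜ x (M.m e)) : ∃ e' ∈ D, M.At e' x := by
  by_contra hcon
  push Not at hcon
  obtain ⟨y, hy, hA⟩ := M.exists_At e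
  have := M.chain (fun z => Conn M.W x z) (fun a b hab h => h.trans hab) D
    (fun e' he' a _ b _ h1 _ h3 => absurd (h1.of_conn M h3) (hcon e' he')) x hx y hy
    (h.trans (hA.conn M he).symm) (Conn.refl hx)
  exact hcon e he (hA.of_conn M this)

theorem face_edge [Nonempty E] {x : ℂ} (hx : x ∈ M.W) : ∃ e, M.At e x := by
  obtain ⟨e⟩ := ‹Nonempty E›
  have : Conn (M.K univᶜ)ᶜ x (M.m e) := by
    refine ⟨(M.K univᶜ)ᶜ, Subset.rfl, ?_, M.W_sub _ hx, M.m_mem (by simp)⟩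
    have h1 : M.K univᶜ = range M.pt := by simp [K]
    rw [h1]
    exact ((finite_range M.pt).countable.isConnected_compl_of_one_lt_rank
      rank_C).isPreconnected
  obtain ⟨e', -, h⟩ := M.exists_at hx (mem_univ e) this
  exact ⟨e', h⟩

/-! ### Around a vertex -/

def K0 (v : V) : Set ℂ := (⋃ e ∈ (M.D v)ᶜ, range (M.γ e)) ∪ M.pt '' {v}ᶜ

theorem K0_union (v : V) : M.K (M.D v)ᶜ = insert (M.pt v) (M.K0 v) := by
  unfold K K0
  rw [← union_insert, ← image_insert_eq]
  congr 1
  have : insert v {v}ᶜ = univ := by ext; simp [em]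
  rw [this, image_univ]

theorem K0_compact (v : V) : IsCompact (M.K0 v) :=
  ((toFinite _).isCompact_biUnion fun e _ => isCompact_range (M.cont e)).union
    (toFinite _).isCompact

theorem pt_notMem_K0 (v : V) : M.pt v ∉ M.K0 v := by
  rintro (h | h)
  · simp only [mem_iUnion] at h
    obtain ⟨e, he, h⟩ := h
    exact he ((M.pt_mem e v h).elim (fun h => Or.inl h.symm) (fun h => Or.inr h.symm))
  · obtain ⟨u, hu, h⟩ := h
    exact hu (M.pt_inj h)

theorem ball (v : V) : ∃ r > 0, IsPreconnected {z | ‖z - M.pt v‖ ∈ Ioo 0 r} ∧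
    {z | ‖z - M.pt v‖ ∈ Ioo 0 r} ⊆ (M.K (M.D v)ᶜ)ᶜ := by
  obtain ⟨r, hr, hb⟩ := Metric.isOpen_iff.1 (M.K0_compact v).isClosed.isOpen_compl _
    (M.pt_notMem_K0 v)
  refine ⟨r, hr, preconn_annulus _ _ ordConnected_Ioo (fun _ h => h.1), ?_⟩
  rintro z ⟨hz0, hzr⟩ hz
  rw [K0_union] at hz
  rcases hz with rfl | hz
  · simp at hz0
  · exact hb (by simpa [dist_eq_norm] using hzr) hz

theorem near_end {e : E} {v : V} (he : e ∈ M.D v) {r : ℝ} (hr : 0 < r) :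
    ∃ t, t ≠ 0 ∧ t ≠ 1 ∧ ‖M.γ e t - M.pt v‖ ∈ Ioo 0 r := by
  obtain ⟨s, hs, hsv⟩ : ∃ s : unitInterval, (s = 0 ∨ s = 1) ∧ M.γ e s = M.pt v := by
    rcases he with rfl | rfl
    · exact ⟨0, Or.inl rfl, M.γ0 e⟩
    · exact ⟨1, Or.inr rfl, M.γ1 e⟩
  have hopen : IsOpen (M.γ e ⁻¹' Metric.ball (M.pt v) r) := Metric.isOpen_ball.preimage (M.cont e)
  have hd : Dense ({0, 1}ᶜ : Set unitInterval) := by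
    rw [compl_eq_univ_sdiff]; exact dense_univ.sdiff_finite (toFinite _)
  obtain ⟨t, ht, ht2⟩ := hd.inter_open_nonempty _ hopen ⟨s, by simp [hsv, hr]⟩
  simp only [mem_compl_iff, mem_insert_iff, mem_singleton_iff, not_or] at ht2
  refine ⟨t, ht2.1, ht2.2, norm_pos_iff.2 ?_, by simpa [dist_eq_norm] using ht⟩
  intro h0
  exact M.not_end ht2.1 ht2.2 ⟨v, (sub_eq_zero.1 h0).symm⟩

theorem star {v : V} {e e' : E} (he : e ∈ M.D v) (he' : e' ∈ M.D v) :
    Conn (M.K (M.D v)ᶜ)ᶜ (M.m e) (M.m e') := by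
  obtain ⟨r, hr, hp, hs⟩ := M.ball v
  obtain ⟨t, h0, h1, h2⟩ := M.near_end he hr
  obtain ⟨t', h0', h1', h2'⟩ := M.near_end he' hr
  exact ((M.int_conn (by simpa using he) h0 h1).trans ⟨_, hs, hp, h2, h2'⟩).trans
    (M.int_conn (by simpa using he') h0' h1').symm

theorem at_conn {v : V} {e e' : E} (he : e ∈ M.D v) (he' : e' ∈ M.D v) {x : ℂ} (h : M.At e x) :
    Conn (M.K (M.D v)ᶜ)ᶜ x (M.m e') :=
  (h.conn M he).trans (M.star he he')

/-- (T7) -/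
theorem frontier_at {v : V} (hv : (M.D v).Nonempty) {x : ℂ} (hx : x ∈ M.W)
    (h : M.pt v ∈ closure {z | Conn M.W x z}) : ∃ e ∈ M.D v, M.At e x := by
  obtain ⟨e, he⟩ := hv
  obtain ⟨r, hr, hp, hs⟩ := M.ball v
  obtain ⟨t, h0, h1, h2⟩ := M.near_end he hr
  obtain ⟨z, hz, hz2⟩ := Metric.mem_closure_iff.1 h r hr
  have hz3 : ‖z - M.pt v‖ ∈ Ioo 0 r := by
    refine ⟨norm_pos_iff.2 fun h => ?_, by rwa [← dist_eq_norm, dist_comm]⟩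
    have := Conn.right hz
    rw [sub_eq_zero.1 h] at this
    exact this (M.pt_mem_K _ v)
  refine M.exists_at hx he (((Conn.mono hz (M.W_sub _)).trans ⟨_, hs, hp, hz3, h2⟩).trans
    (M.int_conn (by simpa using he) h0 h1).symm)

/-- (T3) -/
theorem local_conn {α : Type} {v : V} (φ : E → α)
    (h : ∀ e ∈ M.D v, ∀ e' ∈ M.D v, (∃ x ∈ M.W, M.At e x ∧ M.At e' x) → φ e = φ e') :
    ∀ e ∈ M.D v, ∀ e' ∈ M.D v, φ e = φ e' := by
  intro e he e' he'
  obtain ⟨x, hx, hA⟩ := M.exists_At e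
  obtain ⟨y, hy, hA'⟩ := M.exists_At e'
  obtain ⟨f, hf, hfy, hfe⟩ := M.chain (fun z => ∃ f ∈ M.D v, M.At f z ∧ φ f = φ e)
    (fun a b hab ⟨f, h1, h2, h3⟩ => ⟨f, h1, h2.of_conn M hab.symm, h3⟩) (M.D v)
    (fun f hf a ha b hb h1 h2 ⟨f', h3, h4, h5⟩ =>
      ⟨f, hf, h2, (h f hf f' h3 ⟨a, ha, h1, h4⟩).trans h5⟩) x hx y hy
      ((M.at_conn he he' hA).trans (M.at_conn he' he' hA').symm) ⟨e, he, hA, rfl⟩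
  exact hfe.symm.trans (h f hf e' he' ⟨y, hy, hfy, hA'⟩)

/-- (T4) -/
theorem corner_two {v : V} {e e1 : E} (he : e ∈ M.D v) (he1 : e1 ∈ M.D v) (hne : e1 ≠ e) {x : ℂ}
    (hx : x ∈ M.W) (h : M.At e x) : ∃ e' ∈ M.D v, e' ≠ e ∧ M.At e' x := by
  have hc := M.at_conn he he1 h
  have heq : M.K (M.D v \ {e})ᶜ = M.K0 v ∪ range (M.γ e) := by
    have h1 : (M.D v \ {e})ᶜ = insert e (M.D v)ᶜ := by
      ext a; simp only [mem_compl_iff, mem_sdiff, mem_singleton_iff, mem_insert_iff]; tauto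
    rw [h1, K_insert, K0_union, insert_union]
    refine insert_eq_of_mem (Or.inr ?_)
    rcases he with rfl | rfl
    · exact ⟨0, M.γ0 e⟩
    · exact ⟨1, M.γ1 e⟩
  have hmem : e1 ∈ M.D v \ {e} := ⟨he1, hne⟩
  have hc2 : Conn (M.K (M.D v \ {e})ᶜ)ᶜ x (M.m e1) := by
    rw [heq]
    obtain ⟨p, hp⟩ : ∃ p, range (M.γ e) ∩ M.K0 v ⊆ {p} := by
      have h2 : range (M.γ e) ∩ M.K0 v ⊆ {M.γ e 0, M.γ e 1} := by
        refine Subset.trans (inter_subset_inter_right _ ?_) (M.arc_inter_K (C := (M.D v)ᶜ) (by simpa using he))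
        rw [K0_union]; exact subset_insert _ _
      rcases he with rfl | rfl
      · refine ⟨M.γ e 1, fun z hz => (h2 hz).resolve_left ?_⟩
        rintro rfl; rw [M.γ0] at hz; exact M.pt_notMem_K0 _ hz.2
      · refine ⟨M.γ e 0, fun z hz => (h2 hz).resolve_right ?_⟩
        rintro rfl; rw [M.γ1] at hz; exact M.pt_notMem_K0 _ hz.2
    refine le_one (M.K0_compact v) (M.cont e) (M.inj e) p hp ?_ ?_ (hc.mono ?_)
    · rw [← heq]; exact M.W_sub _ hx
    · rw [← heq]; exact M.m_mem (by simpa using hmem)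
    · rw [K0_union]; exact compl_subset_compl.2 (subset_insert _ _)
  obtain ⟨e', h1, h2⟩ := M.exists_at hx hmem hc2
  exact ⟨e', h1.1, h1.2, h2⟩

/-! ### Links and counting -/

def Lk (C : Set E) (u w : V) : Prop :=
  ∃ e ∈ C, (M.src e = u ∧ M.tgt e = w) ∨ (M.src e = w ∧ M.tgt e = u)

theorem lk_mono {C C' : Set E} (hC : C ⊆ C') {u w : V} (h : Relation.ReflTransGen (M.Lk C) u w) :
    Relation.ReflTransGen (M.Lk C') u w := by
  induction h with
  | refl => exact .refl
  | tail _ h ih => obtain ⟨f, hf, h⟩ := h; exact ih.tail ⟨f, hC hf, h⟩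

theorem joined {C : Set E} {u w : V} (h : Relation.ReflTransGen (M.Lk C) u w) :
    JoinedIn (M.K C) (M.pt u) (M.pt w) := by
  have hedge : ∀ e ∈ C, JoinedIn (M.K C) (M.pt (M.src e)) (M.pt (M.tgt e)) := by
    intro e he
    refine ⟨⟨⟨M.γ e, M.cont e⟩, M.γ0 e, M.γ1 e⟩, fun t => Or.inl ?_⟩
    simp only [mem_iUnion]
    exact ⟨e, he, t, rfl⟩
  induction h with
  | refl => exact JoinedIn.refl (M.pt_mem_K _ _)
  | tail _ h ih =>
    refine ih.trans ?_
    obtain ⟨e, he, ⟨rfl, rfl⟩ | ⟨rfl, rfl⟩⟩ := h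
    · exact hedge e he
    · exact (hedge e he).symm

/-- splitting -/
theorem split {e : E} {C : Set E} (he : e ∉ C)
    (hj : Relation.ReflTransGen (M.Lk C) (M.src e) (M.tgt e)) :
    ∃ x ∈ M.W, ∃ y ∈ M.W, Conn (M.K C)ᶜ x (M.m e) ∧ Conn (M.K C)ᶜ y (M.m e) ∧
      ¬ Conn (M.K (insert e C))ᶜ x y := by
  obtain ⟨x, y, hx, hy, h1, h2, h3⟩ := ge_two (M.K_compact C).isClosed (M.cont e) (M.inj e)
    (M.arc_inter_K he) (by rw [M.γ0, M.γ1]; exact M.joined hj) (M.m e)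
    (fun t h0 h1 => M.int_conn he h0 h1)
  rw [← K_insert] at hx hy h3
  obtain ⟨x', hx', hxx⟩ := M.perturb hx
  obtain ⟨y', hy', hyy⟩ := M.perturb hy
  have hm := M.Kc_mono (subset_insert e C)
  exact ⟨x', hx', y', hy', (h1.trans (hxx.mono hm)).symm, (h2.trans (hyy.mono hm)).symm,
    fun h => h3 ((hxx.trans h).trans hyy.symm)⟩

theorem count (C0 : Set E) (B : Set ℂ) (hB : ∃ x ∈ M.W, x ∈ B)
    (hj : ∀ e ∉ C0, Relation.ReflTransGen (M.Lk C0) (M.src e) (M.tgt e))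
    (hBm : ∀ e ∉ C0, ∀ x ∈ M.W, Conn (M.K C0)ᶜ x (M.m e) → x ∈ B) (A : Finset E)
    (hA : Disjoint (A : Set E) C0) :
    ∃ s : Finset ℂ, (∀ x ∈ s, x ∈ M.W ∧ x ∈ B) ∧
      (∀ x ∈ s, ∀ y ∈ s, x ≠ y → ¬ Conn (M.K (C0 ∪ A))ᶜ x y) ∧ s.card = 1 + A.card := by
  classical
  induction A using Finset.induction_on with
  | empty =>
    obtain ⟨x, hx, hxB⟩ := hB
    refine ⟨{x}, by simpa using ⟨hx, hxB⟩, ?_, by simp⟩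
    intro a ha b hb hab
    simp only [Finset.mem_singleton] at ha hb
    exact absurd (ha.trans hb.symm) hab
  | @insert e A he ih =>
    rw [Finset.coe_insert, disjoint_insert_left] at hA
    obtain ⟨s, h1, h2, h3⟩ := ih hA.2
    have heC : e ∉ C0 ∪ (A : Set E) := by
      rintro (h | h)
      · exact hA.1 h
      · exact he h
    have hlk : Relation.ReflTransGen (M.Lk (C0 ∪ A)) (M.src e) (M.tgt e) :=
      M.lk_mono subset_union_left (hj e hA.1)
    obtain ⟨x, hx, y, hy, hxm, hym, hxy⟩ := M.split heC hlk
    have hm := M.Kc_mono (subset_insert e (C0 ∪ (A : Set E)))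
    have hz : ∃ z ∈ M.W, Conn (M.K (C0 ∪ A))ᶜ z (M.m e) ∧
        ∀ a ∈ s, ¬ Conn (M.K (insert e (C0 ∪ A)))ᶜ a z := by
      by_contra hcon
      push Not at hcon
      obtain ⟨a, ha, hax⟩ := hcon x hx hxm
      obtain ⟨b, hb, hby⟩ := hcon y hy hym
      by_cases hab : a = b
      · subst hab; exact hxy (hax.symm.trans hby)
      · exact h2 a ha b hb hab ((((hax.mono hm).trans hxm).trans hym.symm).trans (hby.mono hm).symm)
    obtain ⟨z, hzW, hzm, hzs⟩ := hz
    have hzs' : z ∉ s := fun h => hzs z h (Conn.refl (M.W_sub _ hzW))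
    have heq : C0 ∪ ((insert e A : Finset E) : Set E) = insert e (C0 ∪ A) := by
      rw [Finset.coe_insert, union_insert]
    rw [heq]
    refine ⟨insert z s, ?_, ?_, ?_⟩
    · intro a ha
      rcases Finset.mem_insert.1 ha with rfl | ha
      · exact ⟨hzW, hBm e hA.1 _ hzW (hzm.mono (M.Kc_mono subset_union_left))⟩
      · exact h1 a ha
    · intro a ha b hb hab
      rcases Finset.mem_insert.1 ha with rfl | ha' <;> rcases Finset.mem_insert.1 hb with rfl | hb'
      · exact absurd rfl hab
      · exact fun h => hzs b hb' h.symm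
      · exact hzs a ha'
      · exact fun h => h2 a ha' b hb' hab (h.mono hm)
    · rw [Finset.card_insert_of_notMem hzs', Finset.card_insert_of_notMem he, h3]; ring

end CEmb

end PF

open Set Topology

namespace PF
namespace CEmb

variable {V E : Type} (M : CEmb V E)

/-- the setoid of faces -/
def fs : Setoid M.W where
  r x y := Conn M.W x y
  iseqv := ⟨fun x => Conn.refl x.2, fun h => h.symm, fun h h' => h.trans h'⟩

def Face : Type := Quotient M.fs

def fc (x : ℂ) (hx : x ∈ M.W) : M.Face := Quotient.mk M.fs ⟨x, hx⟩

def AtF (e : E) (F : M.Face) : Prop :=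
  Quotient.lift (s := M.fs) (fun x : M.W => M.At e x) (fun _ _ h =>
    propext ⟨fun h' => h'.of_conn M (Conn.symm h), fun h' => h'.of_conn M h⟩) F

theorem atF_mk {e : E} {x : ℂ} {hx : x ∈ M.W} : M.AtF e (M.fc x hx) ↔ M.At e x := Iff.rfl

theorem fc_eq {x y : ℂ} {hx : x ∈ M.W} {hy : y ∈ M.W} : M.fc x hx = M.fc y hy ↔ Conn M.W x y :=
  Quotient.eq (r := M.fs)

theorem fc_surj (F : M.Face) : ∃ x hx, M.fc x hx = F := by
  induction F using Quotient.inductionOn with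
  | h x => exact ⟨x.1, x.2, rfl⟩

theorem src_ne_tgt (e : E) : M.src e ≠ M.tgt e := by
  intro h
  have : M.γ e 0 = M.γ e 1 := by rw [M.γ0, M.γ1, h]
  exact zero_ne_one (M.inj e this)

variable [Finite V] [Finite E]

theorem at_le_two {e : E} (F : Fin 3 → M.Face) (hF : ∀ i, M.AtF e (F i)) :
    ∃ i j, i ≠ j ∧ F i = F j := by
  choose x hx hxF using fun i => M.fc_surj (F i)
  have hA : ∀ i, M.At e (x i) := fun i => by
    rw [← M.atF_mk (hx := hx i), hxF]; exact hF i
  have hK : M.K univ = M.K {e}ᶜ ∪ range (M.γ e) := by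
    rw [← K_insert]; congr 1; ext a; simp [em]
  obtain ⟨i, j, hij, h⟩ := le_two (M.K_compact {e}ᶜ) (M.cont e) (M.inj e) (M.src_mem_K e _) (M.tgt_mem_K e _)
    (M.arc_inter_K (by simp)) x (fun i => by rw [← hK]; exact hx i)
    (fun i j => (hA i).trans (hA j).symm)
  refine ⟨i, j, hij, ?_⟩
  rw [← hxF i, ← hxF j, fc_eq, W, hK]
  exact h

theorem at_fin (e : E) : {F | M.AtF e F}.Finite ∧ {F | M.AtF e F}.ncard ≤ 2 := by
  have h : {F | M.AtF e F}.encard ≤ 2 := by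
    by_contra hcon
    rw [not_le] at hcon
    have h3 : (3 : ℕ∞) ≤ {F | M.AtF e F}.encard := by
      have := Order.add_one_le_of_lt hcon
      norm_num at this
      exact this
    obtain ⟨t, ht, ht3⟩ := exists_subset_encard_eq h3
    rw [encard_eq_three] at ht3
    obtain ⟨a, b, c, hab, hac, hbc, rfl⟩ := ht3
    obtain ⟨i, j, hij, h⟩ := M.at_le_two (e := e) ![a, b, c] (by
      intro i; fin_cases i
      · exact ht (by simp)
      · exact ht (by simp)
      · exact ht (by simp))
    fin_cases i <;> fin_cases j <;> simp_all
  have hf : {F | M.AtF e F}.Finite := finite_of_encard_le_coe h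
  refine ⟨hf, ?_⟩
  rw [← hf.cast_ncard_eq] at h
  exact_mod_cast h

theorem face_edgeF [Nonempty E] (F : M.Face) : ∃ e, M.AtF e F := by
  obtain ⟨x, hx, rfl⟩ := M.fc_surj F
  exact M.face_edge hx

theorem finite_face [Nonempty E] : Finite M.Face := by
  rw [← finite_univ_iff]
  refine (finite_iUnion fun e => (M.at_fin e).1).subset ?_
  intro F _
  simpa using M.face_edgeF F

theorem corner_twoF {v : V} {e e1 : E} (he : e ∈ M.D v) (he1 : e1 ∈ M.D v) (hne : e1 ≠ e)
    {F : M.Face} (h : M.AtF e F) : ∃ e' ∈ M.D v, e' ≠ e ∧ M.AtF e' F := by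
  obtain ⟨x, hx, rfl⟩ := M.fc_surj F
  exact M.corner_two he he1 hne hx h

theorem local_connF {α : Type} {v : V} (φ : E → α)
    (h : ∀ e ∈ M.D v, ∀ e' ∈ M.D v, (∃ F, M.AtF e F ∧ M.AtF e' F) → φ e = φ e') :
    ∀ e ∈ M.D v, ∀ e' ∈ M.D v, φ e = φ e' := by
  refine M.local_conn φ fun e he e' he' ⟨x, hx, h1, h2⟩ => h e he e' he' ⟨M.fc x hx, h1, h2⟩

/-- the connectivity hypotheses -/
structure Good : Prop where
  cut : ∀ v u w, u ≠ v → w ≠ v → Relation.ReflTransGen (M.Lk (M.D v)ᶜ) u w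
  deg : ∀ v, 3 ≤ (M.D v).ncard
  tree : ∃ C0 : Set E, C0.ncard + 1 = Nat.card V ∧ ∀ u w, Relation.ReflTransGen (M.Lk C0) u w

variable {M}

theorem Good.other (hM : M.Good) (v : V) (e : E) : ∃ e1 ∈ M.D v, e1 ≠ e :=
  exists_ne_of_one_lt_ncard (lt_of_lt_of_le (by norm_num) (hM.deg v)) e

/-- From an edge at `v` one can go to another endpoint `≠ v`. -/
theorem step {v : V} {e : E} (he : e ∈ M.D v) {C : Set E} (hC : e ∈ C) :
    ∃ u, u ≠ v ∧ M.Lk C v u ∧ M.Lk C u v := by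
  rcases he with rfl | rfl
  · exact ⟨M.tgt e, (M.src_ne_tgt e).symm, ⟨e, hC, Or.inl ⟨rfl, rfl⟩⟩, ⟨e, hC, Or.inr ⟨rfl, rfl⟩⟩⟩
  · exact ⟨M.src e, M.src_ne_tgt e, ⟨e, hC, Or.inr ⟨rfl, rfl⟩⟩, ⟨e, hC, Or.inl ⟨rfl, rfl⟩⟩⟩

/-- everything is linked in `(D v)ᶜ ∪ {e1}` if `e1` is at `v`. -/
theorem Good.link (hM : M.Good) {v : V} {e1 : E} (he1 : e1 ∈ M.D v) (u w : V) :
    Relation.ReflTransGen (M.Lk (insert e1 (M.D v)ᶜ)) u w := by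
  obtain ⟨a, hav, h1, h2⟩ := step he1 (C := insert e1 (M.D v)ᶜ) (mem_insert _ _)
  have hm : ∀ u w, u ≠ v → w ≠ v → Relation.ReflTransGen (M.Lk (insert e1 (M.D v)ᶜ)) u w :=
    fun u w hu hw => M.lk_mono (subset_insert _ _) (hM.cut v u w hu hw)
  have hA : ∀ u, Relation.ReflTransGen (M.Lk (insert e1 (M.D v)ᶜ)) u a := by
    intro u
    by_cases hu : u = v
    · subst hu; exact .single h1
    · exact hm u a hu hav
  have hB : ∀ u, Relation.ReflTransGen (M.Lk (insert e1 (M.D v)ᶜ)) a u := by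
    intro u
    by_cases hu : u = v
    · subst hu; exact .single h2
    · exact hm a u hav hu
  exact (hA u).trans (hB w)

theorem Good.two (hM : M.Good) (e : E) : {F | M.AtF e F}.ncard = 2 := by
  refine le_antisymm (M.at_fin e).2 ?_
  obtain ⟨e1, he1, hne⟩ := hM.other (M.src e) e
  have hl := hM.link he1 (M.src e) (M.tgt e)
  have hl' : Relation.ReflTransGen (M.Lk {e}ᶜ) (M.src e) (M.tgt e) := by
    refine M.lk_mono ?_ hl
    rintro a (rfl | ha)
    · exact hne
    · rintro rfl; exact ha (Or.inl rfl)
  obtain ⟨x, hx, y, hy, h1, h2, h3⟩ := M.split (by simp) hl'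
  have : insert e {e}ᶜ = (univ : Set E) := by ext; simp [em]
  rw [this] at h3
  have : 1 < {F | M.AtF e F}.ncard := by
    rw [one_lt_ncard_iff (M.at_fin e).1]
    exact ⟨M.fc x hx, M.fc y hy, h1, h2, fun h => h3 (M.fc_eq.1 h)⟩
  exact this

theorem count_le (C0 : Set E) (B : Set ℂ) (hB : ∃ x ∈ M.W, x ∈ B)
    (hj : ∀ e ∉ C0, Relation.ReflTransGen (M.Lk C0) (M.src e) (M.tgt e))
    (hBm : ∀ e ∉ C0, ∀ x ∈ M.W, Conn (M.K C0)ᶜ x (M.m e) → x ∈ B) [Finite M.Face] (T : Set M.Face)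
    (hT : ∀ x (hx : x ∈ M.W), x ∈ B → M.fc x hx ∈ T) : 1 + C0ᶜ.ncard ≤ T.ncard := by
  classical
  have hfin : (C0ᶜ).Finite := toFinite _
  obtain ⟨s, h1, h2, h3⟩ := M.count C0 B hB hj hBm hfin.toFinset (by
    simpa using disjoint_compl_left)
  rw [← ncard_eq_toFinset_card _ hfin] at h3
  have hu : C0 ∪ (hfin.toFinset : Set E) = univ := by simp
  rw [hu] at h2
  rw [← h3, ← ncard_coe_finset]
  refine ncard_le_ncard_of_injOn (fun x => if hx : x ∈ M.W then M.fc x hx else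
    Classical.choice ⟨M.fc _ hB.choose_spec.1⟩) ?_ ?_ (toFinite _)
  · intro x hx
    simp only [dif_pos (h1 x hx).1]
    exact hT x _ (h1 x hx).2
  · intro x hx y hy hxy
    simp only [dif_pos (h1 x hx).1, dif_pos (h1 y hy).1] at hxy
    by_contra hne
    exact h2 x hx y hy hne (M.fc_eq.1 hxy)

theorem Good.euler (hM : M.Good) [Finite M.Face] : Nat.card E + 2 ≤ Nat.card V + Nat.card M.Face := by
  obtain ⟨C0, hc, hl⟩ := hM.tree
  have h := count_le (M := M) C0 univ (by
      obtain ⟨z, -, hz⟩ := M.exists_W isOpen_univ univ_nonempty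
      exact ⟨z, hz, mem_univ _⟩) (fun e _ => hl _ _) (fun _ _ _ _ _ => mem_univ _) univ
      (fun _ _ _ => mem_univ _)
  rw [ncard_univ] at h
  have := ncard_add_ncard_compl C0
  omega

theorem Good.faces_at (hM : M.Good) [Finite M.Face] (v : V) :
    (M.D v).ncard ≤ {F | ∃ e ∈ M.D v, M.AtF e F}.ncard := by
  have hpos : 0 < (M.D v).ncard := lt_of_lt_of_le (by norm_num) (hM.deg v)
  obtain ⟨e0, he0⟩ := nonempty_of_ncard_ne_zero hpos.ne'
  obtain ⟨x0, hx0, hA0⟩ := M.exists_At e0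
  have h := count_le (M := M) (insert e0 (M.D v)ᶜ) {x | Conn (M.K (M.D v)ᶜ)ᶜ x (M.m e0)}
    ⟨x0, hx0, hA0.conn M he0⟩ (fun e _ => hM.link he0 _ _) (by
      intro e he x hx hc
      have heD : e ∈ M.D v := by
        by_contra h; exact he (Or.inr h)
      exact (hc.mono (M.Kc_mono (subset_insert _ _))).trans (M.star heD he0))
    {F | ∃ e ∈ M.D v, M.AtF e F} (fun x hx hc => M.exists_at hx he0 hc)
  have heq : (insert e0 (M.D v)ᶜ)ᶜ = M.D v \ {e0} := by
    ext a; simp only [mem_compl_iff, mem_insert_iff, mem_sdiff, mem_singleton_iff]; rw [not_or, not_not, and_comm]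
  rw [heq, ncard_sdiff_singleton_of_mem he0] at h
  omega

end CEmb
end PF

open Set Topology

namespace PF

/-- Combinatorial data of a plane graph. -/
structure Comb (V E Fc : Type) where
  src : E → V
  tgt : E → V
  At : E → Fc → Prop

namespace Comb

variable {V E Fc : Type} (M : Comb V E Fc)

def Inc (e : E) (v : V) : Prop := M.src e = v ∨ M.tgt e = v

/-- edge `e` lies at the corner `(v, F)` -/
def AtC (v : V) (F : Fc) (e : E) : Prop := M.Inc e v ∧ M.At e F

section

open Classical

variable [Fintype V] [Fintype E] [Fintype Fc]

structure Good : Prop where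
  ne : ∀ e, M.src e ≠ M.tgt e
  simple : ∀ e e' a b, a ≠ b → M.Inc e a → M.Inc e b → M.Inc e' a → M.Inc e' b → e = e'
  two : ∀ e, (Finset.univ.filter fun F => M.At e F).card = 2
  face : ∀ F, ∃ e, M.At e F
  corner : ∀ v e F, M.Inc e v → M.At e F → ∃ e', e' ≠ e ∧ M.Inc e' v ∧ M.At e' F
  loc : ∀ {α : Type} (v : V) (φ : E → α),
    (∀ e e', M.Inc e v → M.Inc e' v → (∃ F, M.At e F ∧ M.At e' F) → φ e = φ e') →
    ∀ e e', M.Inc e v → M.Inc e' v → φ e = φ e'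
  euler : Fintype.card E + 2 ≤ Fintype.card V + Fintype.card Fc
  facesat : ∀ v, (Finset.univ.filter fun e => M.Inc e v).card ≤
    (Finset.univ.filter fun F => ∃ e, M.AtC v F e).card
  deg : ∀ v, 3 ≤ (Finset.univ.filter fun e => M.Inc e v).card
  conn : ∀ u w, Relation.ReflTransGen (fun x y => ∃ e, M.Inc e x ∧ M.Inc e y) u w
  conn2 : ∀ a b u w, a ≠ b → u ≠ a → u ≠ b → w ≠ a → w ≠ b → 
    Relation.ReflTransGen (fun x y => (∃ e, M.Inc e x ∧ M.Inc e y) ∧ y ≠ a ∧ y ≠ b) u w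

variable {M}

theorem Good.inc_two (hM : M.Good) (e : E) : (Finset.univ.filter fun v => M.Inc e v).card = 2 := by
  have : (Finset.univ.filter fun v => M.Inc e v) = {M.src e, M.tgt e} := by
    ext v; simp [Inc, eq_comm]
  rw [this, Finset.card_pair (hM.ne e)]

theorem Good.two_le (hM : M.Good) {v : V} {F : Fc} (h : ∃ e, M.AtC v F e) :
    2 ≤ (Finset.univ.filter fun e => M.AtC v F e).card := by
  obtain ⟨e, he⟩ := h
  obtain ⟨e', hne, h1, h2⟩ := hM.corner v e F he.1 he.2
  have : ({e, e'} : Finset E) ⊆ Finset.univ.filter fun e => M.AtC v F e := by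
    intro a ha
    simp only [Finset.mem_insert, Finset.mem_singleton] at ha
    simp only [Finset.mem_filter, Finset.mem_univ, true_and]
    rcases ha with rfl | rfl
    · exact he
    · exact ⟨h1, h2⟩
  calc 2 = ({e, e'} : Finset E).card := (Finset.card_pair hne.symm).symm
    _ ≤ _ := Finset.card_le_card this

theorem Good.sum_corner (hM : M.Good) (v : V) :
    ∑ F ∈ Finset.univ.filter (fun F => ∃ e, M.AtC v F e),
      (Finset.univ.filter fun e => M.AtC v F e).card =
    2 * (Finset.univ.filter fun e => M.Inc e v).card := by
  have h1 : ∀ F, (Finset.univ.filter fun e => M.AtC v F e) =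
      ((Finset.univ.filter fun e => M.Inc e v).filter fun e => M.At e F) := by
    intro F; ext e; rw [Finset.mem_filter, Finset.mem_filter, Finset.mem_filter]; simp [AtC]
  have h2 := Finset.sum_card_bipartiteAbove_eq_sum_card_bipartiteBelow
    (s := Finset.univ.filter fun e => M.Inc e v) (t := (Finset.univ : Finset Fc)) (fun e F => M.At e F)
  simp only [Finset.bipartiteAbove, Finset.bipartiteBelow, hM.two] at h2
  rw [Finset.sum_const, smul_eq_mul, mul_comm] at h2
  rw [h2]
  simp_rw [← h1]
  refine Finset.sum_subset (Finset.subset_univ _) ?_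
  intro F _ hF
  simp only [Finset.mem_filter, Finset.mem_univ, true_and, not_exists] at hF
  simp [hF]

theorem Good.card_corner (hM : M.Good) {v : V} {F : Fc} (h : ∃ e, M.AtC v F e) :
    (Finset.univ.filter fun e => M.AtC v F e).card = 2 := by
  have h1 := hM.sum_corner v
  have h2 := hM.facesat v
  by_contra hne
  have h3 : 2 < (Finset.univ.filter fun e => M.AtC v F e).card :=
    lt_of_le_of_ne (hM.two_le h) (Ne.symm hne)
  have : ∑ F ∈ Finset.univ.filter (fun F => ∃ e, M.AtC v F e), 2 <
      ∑ F ∈ Finset.univ.filter (fun F => ∃ e, M.AtC v F e),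
      (Finset.univ.filter fun e => M.AtC v F e).card := by
    refine Finset.sum_lt_sum (fun F hF => hM.two_le (by simpa using hF)) ⟨F, by simpa using h, h3⟩
  rw [Finset.sum_const, smul_eq_mul] at this
  omega

theorem Good.faces_eq (hM : M.Good) (v : V) :
    (Finset.univ.filter fun F => ∃ e, M.AtC v F e).card =
      (Finset.univ.filter fun e => M.Inc e v).card := by
  have h1 := hM.sum_corner v
  rw [Finset.sum_congr rfl (fun F hF => hM.card_corner (by simpa using hF)), Finset.sum_const,
    smul_eq_mul] at h1
  omega

/-- corners -/
abbrev Cor (M : Comb V E Fc) : Type := {p : V × Fc // ∃ e, M.AtC p.1 p.2 e}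

theorem Good.card_cor (hM : M.Good) : Fintype.card M.Cor = 2 * Fintype.card E := by
  have h1 : Fintype.card M.Cor = ∑ v : V, (Finset.univ.filter fun F => ∃ e, M.AtC v F e).card := by
    have : Fintype.card M.Cor = (Finset.univ.filter fun p : V × Fc => ∃ e, M.AtC p.1 p.2 e).card := by
      rw [Fintype.card_subtype]
    rw [this, Finset.card_filter, Fintype.sum_prod_type]
    refine Finset.sum_congr rfl fun v _ => ?_
    rw [Finset.card_filter]
  rw [h1, Finset.sum_congr rfl (fun v _ => hM.faces_eq v)]
  have h2 := Finset.sum_card_bipartiteAbove_eq_sum_card_bipartiteBelow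
    (s := (Finset.univ : Finset E)) (t := (Finset.univ : Finset V)) (fun e v => M.Inc e v)
  simp only [Finset.bipartiteAbove, Finset.bipartiteBelow, hM.inc_two] at h2
  rw [← h2]; simp [mul_comm]

/-- the coboundary -/
noncomputable def del (M : Comb V E Fc) (φ : E → ZMod 2) (v : V) (F : Fc) : ZMod 2 :=
  ∑ e ∈ Finset.univ.filter (fun e => M.AtC v F e), φ e

theorem Good.del_pair (hM : M.Good) {φ : E → ZMod 2} {v : V} {F : Fc} {e e' : E} (hne : e ≠ e')
    (h : M.AtC v F e) (h' : M.AtC v F e') : M.del φ v F = φ e + φ e' := by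
  have : ({e, e'} : Finset E) = Finset.univ.filter fun e => M.AtC v F e := by
    refine Finset.eq_of_subset_of_card_le ?_ ?_
    · intro a ha
      simp only [Finset.mem_insert, Finset.mem_singleton] at ha
      simp only [Finset.mem_filter, Finset.mem_univ, true_and]
      rcases ha with rfl | rfl
      · exact h
      · exact h'
    · rw [hM.card_corner ⟨e, h⟩, Finset.card_pair hne]
  rw [del, ← this, Finset.sum_pair hne]

theorem two_eq {a b : ZMod 2} (h : a + b = 0) : a = b := by
  revert a b; decide

theorem Good.eq_of_del (hM : M.Good) {φ : E → ZMod 2} {v : V} {F : Fc} {e e' : E}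
    (h : M.AtC v F e) (h' : M.AtC v F e') (h0 : M.del φ v F = 0) : φ e = φ e' := by
  by_cases hne : e = e'
  · rw [hne]
  · rw [hM.del_pair hne h h'] at h0
    exact two_eq h0

theorem Good.const_at (hM : M.Good) {φ : E → ZMod 2} {v : V} (h : ∀ F, M.del φ v F = 0) :
    ∀ e e', M.Inc e v → M.Inc e' v → φ e = φ e' :=
  hM.loc v φ fun e e' he he' ⟨F, h1, h2⟩ => hM.eq_of_del ⟨he, h1⟩ ⟨he', h2⟩ (h F)

theorem Good.del_row (hM : M.Good) (φ : E → ZMod 2) (v : V) : ∑ F, M.del φ v F = 0 := by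
  unfold del
  simp_rw [Finset.sum_filter]
  rw [Finset.sum_comm]
  refine Finset.sum_eq_zero fun e _ => ?_
  by_cases h : M.Inc e v
  · simp only [AtC, h, true_and]
    rw [← Finset.sum_filter, Finset.sum_const, hM.two e, two_nsmul, CharTwo.add_self_eq_zero]
  · simp [AtC, h]

theorem Good.del_col (hM : M.Good) (φ : E → ZMod 2) (F : Fc) : ∑ v, M.del φ v F = 0 := by
  unfold del
  simp_rw [Finset.sum_filter]
  rw [Finset.sum_comm]
  refine Finset.sum_eq_zero fun e _ => ?_
  by_cases h : M.At e F
  · simp only [AtC, h, and_true]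
    rw [← Finset.sum_filter, Finset.sum_const, hM.inc_two e, two_nsmul, CharTwo.add_self_eq_zero]
  · simp [AtC, h]

theorem Good.nonempty_inc (hM : M.Good) (v : V) : ∃ e, M.Inc e v := by
  have : (Finset.univ.filter fun e => M.Inc e v).Nonempty := by
    rw [← Finset.card_pos]; exact lt_of_lt_of_le (by norm_num) (hM.deg v)
  obtain ⟨e, he⟩ := this
  exact ⟨e, by simpa using he⟩

theorem Good.const_all (hM : M.Good) {φ : E → ZMod 2}
    (h : ∀ v, ∀ e e', M.Inc e v → M.Inc e' v → φ e = φ e') : ∀ e e', φ e = φ e' := by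
  have key : ∀ u w, Relation.ReflTransGen (fun x y => ∃ e, M.Inc e x ∧ M.Inc e y) u w →
      ∀ e e', M.Inc e u → M.Inc e' w → φ e = φ e' := by
    intro u w huw
    induction huw with
    | refl => exact h u
    | @tail b c _ hbc ih =>
      intro e e' he he'
      obtain ⟨f, hf1, hf2⟩ := hbc
      exact (ih e f he hf1).trans (h c f e' hf2 he')
  intro e e'
  exact key (M.src e) (M.src e') (hM.conn _ _) e e' (Or.inl rfl) (Or.inl rfl)

theorem finrank_const {ι : Type} [Fintype ι] (p : Submodule (ZMod 2) (ι → ZMod 2))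
    (h : ∀ φ ∈ p, ∀ i j, φ i = φ j) : Module.finrank (ZMod 2) p ≤ 1 := by
  have hle : p ≤ Submodule.span (ZMod 2) {(fun _ => 1 : ι → ZMod 2)} := by
    intro φ hφ
    rw [Submodule.mem_span_singleton]
    by_cases hι : Nonempty ι
    · obtain ⟨i⟩ := hι
      exact ⟨φ i, by ext j; simp [h φ hφ i j]⟩
    · exact ⟨0, by ext j; exact absurd ⟨j⟩ hι⟩
  calc _ ≤ Module.finrank (ZMod 2) (Submodule.span (ZMod 2) {(fun _ => 1 : ι → ZMod 2)}) :=
        Submodule.finrank_mono hle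
    _ ≤ 1 := by
        have := finrank_span_le_card (R := ZMod 2) ({(fun _ => 1)} : Set (ι → ZMod 2))
        simpa using this

noncomputable def Dm (M : Comb V E Fc) : Matrix M.Cor E (ZMod 2) :=
  fun c e => if M.AtC c.1.1 c.1.2 e then 1 else 0

noncomputable def Am (M : Comb V E Fc) : Matrix (V ⊕ Fc) M.Cor (ZMod 2) :=
  fun i c => Sum.elim (fun v => if c.1.1 = v then 1 else 0) (fun F => if c.1.2 = F then 1 else 0) i

theorem Dm_mulVec (φ : E → ZMod 2) (c : M.Cor) : M.Dm.mulVec φ c = M.del φ c.1.1 c.1.2 := by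
  simp [Matrix.mulVec, dotProduct, Dm, del, Finset.sum_filter]

theorem Good.finrank_ker_Dm (hM : M.Good) :
    Module.finrank (ZMod 2) (LinearMap.ker M.Dm.mulVecLin) ≤ 1 := by
  refine finrank_const _ fun φ hφ => hM.const_all fun v => hM.const_at fun F => ?_
  by_cases h : ∃ e, M.AtC v F e
  · have := congrFun (LinearMap.mem_ker.1 hφ) ⟨(v, F), h⟩
    rw [Matrix.mulVecLin_apply, Dm_mulVec] at this
    exact this
  · simp only [not_exists] at h
    simp [del, h]

theorem AmT_mulVec (a : V ⊕ Fc → ZMod 2) (c : M.Cor) :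
    M.Am.transpose.mulVec a c = a (Sum.inl c.1.1) + a (Sum.inr c.1.2) := by
  simp [Matrix.mulVec, dotProduct, Am, Fintype.sum_sum_type]

theorem Good.finrank_ker_AmT (hM : M.Good) :
    Module.finrank (ZMod 2) (LinearMap.ker M.Am.transpose.mulVecLin) ≤ 1 := by
  refine finrank_const _ fun a ha => ?_
  have h1 : ∀ v F, (∃ e, M.AtC v F e) → a (Sum.inl v) = a (Sum.inr F) := by
    intro v F h
    have := congrFun (LinearMap.mem_ker.1 ha) ⟨(v, F), h⟩
    rw [Matrix.mulVecLin_apply, AmT_mulVec] at this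
    exact two_eq this
  have h2 : ∀ u w, a (Sum.inl u) = a (Sum.inl w) := by
    intro u w
    have := hM.conn u w
    induction this with
    | refl => rfl
    | @tail b c _ hbc ih =>
      obtain ⟨e, h3, h4⟩ := hbc
      have : (Finset.univ.filter fun F => M.At e F).Nonempty := by
        rw [← Finset.card_pos, hM.two]; norm_num
      obtain ⟨F, hF⟩ := this
      have hF : M.At e F := by simpa using hF
      rw [ih, h1 b F ⟨e, h3, hF⟩, h1 c F ⟨e, h4, hF⟩]
  have h3 : ∀ i, ∃ v, a i = a (Sum.inl v) := by
    rintro (v | F)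
    · exact ⟨v, rfl⟩
    · obtain ⟨e, he⟩ := hM.face F
      exact ⟨M.src e, (h1 _ F ⟨e, Or.inl rfl, he⟩).symm⟩
  intro i j
  obtain ⟨u, hu⟩ := h3 i
  obtain ⟨w, hw⟩ := h3 j
  rw [hu, hw, h2]

theorem sum_cor (c : V → Fc → ZMod 2) (hc : ∀ v F, (¬ ∃ e, M.AtC v F e) → c v F = 0)
    (g : V → Fc → ZMod 2) : ∑ p : M.Cor, g p.1.1 p.1.2 * c p.1.1 p.1.2 = ∑ v, ∑ F, g v F * c v F := by
  rw [← Fintype.sum_prod_type' (f := fun v F => g v F * c v F)]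
  rw [← Finset.sum_subtype (s := Finset.univ.filter fun p : V × Fc => ∃ e, M.AtC p.1 p.2 e)
    (f := fun p : V × Fc => g p.1 p.2 * c p.1 p.2) (by simp)]
  refine Finset.sum_subset (Finset.subset_univ _) ?_
  intro p _ hp
  rw [hc p.1 p.2 (by simpa using hp), mul_zero]

theorem Am_ker (c : V → Fc → ZMod 2) (hc : ∀ v F, (¬ ∃ e, M.AtC v F e) → c v F = 0)
    (hrow : ∀ v, ∑ F, c v F = 0) (hcol : ∀ F, ∑ v, c v F = 0) :
    M.Am.mulVec (fun p : M.Cor => c p.1.1 p.1.2) = 0 := by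
  ext i
  rcases i with v | F
  · have := sum_cor c hc (fun v' _ => if v' = v then 1 else 0)
    simp only [Matrix.mulVec, dotProduct, Am, Sum.elim_inl, Pi.zero_apply]
    rw [this]
    rw [Finset.sum_eq_single v]
    · simpa using hrow v
    · intro b _ hb; simp [hb]
    · simp
  · have := sum_cor c hc (fun _ F' => if F' = F then 1 else 0)
    simp only [Matrix.mulVec, dotProduct, Am, Sum.elim_inr, Pi.zero_apply]
    rw [this]
    simpa using hcol F

/-- exactness -/
theorem Good.exact (hM : M.Good) (c : V → Fc → ZMod 2)
    (hc : ∀ v F, (¬ ∃ e, M.AtC v F e) → c v F = 0)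
    (hrow : ∀ v, ∑ F, c v F = 0) (hcol : ∀ F, ∑ v, c v F = 0) :
    ∃ φ : E → ZMod 2, ∀ v F, M.del φ v F = c v F := by
  have hle : LinearMap.range M.Dm.mulVecLin ≤ LinearMap.ker M.Am.mulVecLin := by
    rintro _ ⟨φ, rfl⟩
    rw [LinearMap.mem_ker, Matrix.mulVecLin_apply]
    have : M.Dm.mulVecLin φ = fun p : M.Cor => M.del φ p.1.1 p.1.2 := by
      ext p; exact Dm_mulVec φ p
    rw [this]
    refine Am_ker (M.del φ) ?_ (hM.del_row φ) (hM.del_col φ)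
    intro v F h
    simp only [not_exists] at h
    simp [del, h]
  have h1 := M.Dm.mulVecLin.finrank_range_add_finrank_ker
  have h2 := M.Am.mulVecLin.finrank_range_add_finrank_ker
  have h3 := M.Am.transpose.mulVecLin.finrank_range_add_finrank_ker
  have h4 : Module.finrank (ZMod 2) (LinearMap.range M.Am.transpose.mulVecLin) =
    Module.finrank (ZMod 2) (LinearMap.range M.Am.mulVecLin) := Matrix.rank_transpose M.Am
  have h5 := hM.finrank_ker_Dm
  have h6 := hM.finrank_ker_AmT
  have h7 := hM.card_cor
  have h8 := hM.euler
  simp only [Module.finrank_fintype_fun_eq_card, Fintype.card_sum] at h1 h2 h3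
  have heq := Submodule.eq_of_le_of_finrank_le hle (by omega)
  have hmem : (fun p : M.Cor => c p.1.1 p.1.2) ∈ LinearMap.ker M.Am.mulVecLin := by
    rw [LinearMap.mem_ker, Matrix.mulVecLin_apply]
    exact Am_ker c hc hrow hcol
  rw [← heq] at hmem
  obtain ⟨φ, hφ⟩ := hmem
  refine ⟨φ, fun v F => ?_⟩
  by_cases h : ∃ e, M.AtC v F e
  · have := congrFun hφ ⟨(v, F), h⟩
    rw [Matrix.mulVecLin_apply, Dm_mulVec] at this
    exact this
  · rw [hc v F h]
    simp only [not_exists] at h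
    simp [del, h]

end

end Comb
end PF

open Set Topology

namespace PF
namespace Comb

section

open Classical

variable {V E Fc : Type} {M : Comb V E Fc}
variable [Fintype V] [Fintype E] [Fintype Fc]

/-- selected corners -/
def Sel (S : Finset V) (F1 F2 : V → Fc) (v : V) (F : Fc) : Prop := v ∈ S ∧ (F = F1 v ∨ F = F2 v)

structure Selection (M : Comb V E Fc) (S : Finset V) (P : Finset Fc) (F1 F2 : V → Fc) : Prop where
  ne : ∀ v ∈ S, F1 v ≠ F2 v
  mem1 : ∀ v ∈ S, F1 v ∈ P
  mem2 : ∀ v ∈ S, F2 v ∈ P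
  cor1 : ∀ v ∈ S, ∃ e, M.AtC v (F1 v) e
  cor2 : ∀ v ∈ S, ∃ e, M.AtC v (F2 v) e

variable {S : Finset V} {P : Finset Fc} {F1 F2 : V → Fc}

theorem sel_sum (hS : M.Selection S P F1 F2) (y : V → ZMod 2) (v : V) :
    ∑ F, (if Sel S F1 F2 v F then y v else 0) = 0 := by
  by_cases hv : v ∈ S
  · have : ∀ F, Sel S F1 F2 v F ↔ F ∈ ({F1 v, F2 v} : Finset Fc) := by
      intro F; simp [Sel, hv]
    simp_rw [this]
    rw [Finset.sum_ite_mem, Finset.univ_inter, Finset.sum_pair (hS.ne v hv),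
      CharTwo.add_self_eq_zero]
  · simp [Sel, hv]

/-- A lower bound for the number of regions. -/
theorem Good.regions (hM : M.Good) (hS : M.Selection S P F1 F2) {R : Type} [Fintype R] (π : E → R)
    (hπ : ∀ φ : E → ZMod 2, (∀ e e' v F, M.AtC v F e → M.AtC v F e' → ¬ Sel S F1 F2 v F → φ e = φ e') →
      ∃ ψ : R → ZMod 2, ∀ e, φ e = ψ (π e)) :
    S.card ≤ Fintype.card R + P.card := by
  let Λ : (S → ZMod 2) →ₗ[ZMod 2] (P → ZMod 2) :=
    { toFun := fun y F => ∑ v : S, if Sel S F1 F2 v F then y v else 0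
      map_add' := by
        intro y z; ext F
        simp only [Pi.add_apply]
        rw [← Finset.sum_add_distrib]
        refine Finset.sum_congr rfl fun v _ => ?_
        split_ifs <;> simp
      map_smul' := by
        intro a y; ext F
        simp only [Pi.smul_apply, smul_eq_mul, RingHom.id_apply]
        rw [Finset.mul_sum]
        refine Finset.sum_congr rfl fun v _ => ?_
        split_ifs <;> simp }
  let Ψ : (R → ZMod 2) →ₗ[ZMod 2] (S → ZMod 2) :=
    { toFun := fun ψ v => M.del (fun e => ψ (π e)) v (F1 v)
      map_add' := by
        intro y z; ext v
        simp [del, Finset.sum_add_distrib]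
      map_smul' := by
        intro a y; ext v
        simp [del, Finset.mul_sum] }
  have hle : LinearMap.ker Λ ≤ LinearMap.range Ψ := by
    intro y hy
    have hy' : ∀ F ∈ P, ∑ v : S, (if Sel S F1 F2 v F then y v else 0) = 0 :=
      fun F hF => congrFun (LinearMap.mem_ker.1 hy) ⟨F, hF⟩
    let y' : V → ZMod 2 := fun v => if h : v ∈ S then y ⟨v, h⟩ else 0
    obtain ⟨φ, hφ⟩ := hM.exact (fun v F => if Sel S F1 F2 v F then y' v else 0) (by
        intro v F h
        refine if_neg ?_
        rintro ⟨hv, rfl | rfl⟩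
        · exact h (hS.cor1 v hv)
        · exact h (hS.cor2 v hv)) (sel_sum hS y') (by
        intro F
        by_cases hF : F ∈ P
        · refine Eq.trans ?_ (hy' F hF)
          rw [← Finset.sum_subset (Finset.subset_univ S), ← Finset.sum_coe_sort]
          · refine Finset.sum_congr rfl fun v _ => ?_
            simp [y']
          · intro v _ hv
            simp [Sel, hv]
        · refine Finset.sum_eq_zero fun v _ => if_neg ?_
          rintro ⟨hv, rfl | rfl⟩
          · exact hF (hS.mem1 v hv)
          · exact hF (hS.mem2 v hv))
    obtain ⟨ψ, hψ⟩ := hπ φ (by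
      intro e e' v F h h' hn
      refine hM.eq_of_del h h' ?_
      rw [hφ, if_neg hn])
    refine ⟨ψ, ?_⟩
    ext v
    show M.del (fun e => ψ (π e)) v (F1 v) = y v
    have : (fun e => ψ (π e)) = φ := by ext e; exact (hψ e).symm
    rw [this, hφ, if_pos ⟨v.2, Or.inl rfl⟩]
    simp [y']
  have h1 := Λ.finrank_range_add_finrank_ker
  have h2 := Submodule.finrank_mono hle
  have h3 := Ψ.finrank_range_le
  have h4 := Submodule.finrank_le (LinearMap.range Λ)
  simp only [Module.finrank_fintype_fun_eq_card, Fintype.card_coe] at h1 h3 h4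
  omega

section

variable {R : Type} {π : E → R}

theorem Good.nonS (hM : M.Good)
    (hπ : ∀ e e' v F, M.AtC v F e → M.AtC v F e' → ¬ Sel S F1 F2 v F → π e = π e')
    {v : V} (hv : v ∉ S) {e e' : E} (he : M.Inc e v) (he' : M.Inc e' v) : π e = π e' := by
  refine hM.loc v π (fun f f' hf hf' ⟨F, h1, h2⟩ => ?_) e e' he he'
  exact hπ f f' v F ⟨hf, h1⟩ ⟨hf', h2⟩ fun h => hv h.1

theorem Good.touch (hM : M.Good) (hS : M.Selection S P F1 F2)
    (hπ : ∀ e e' v F, M.AtC v F e → M.AtC v F e' → ¬ Sel S F1 F2 v F → π e = π e')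
    {v : V} (hv : v ∈ S) {e1 e2 e3 : E} (h1 : M.Inc e1 v) (h2 : M.Inc e2 v) (h3 : M.Inc e3 v)
    (h12 : π e1 ≠ π e2) (h13 : π e1 ≠ π e3) (h23 : π e2 ≠ π e3) : False := by
  have key : ∀ ψ : R → ZMod 2, M.del (fun e => ψ (π e)) v (F1 v) = 0 →
      ∀ e e', M.Inc e v → M.Inc e' v → ψ (π e) = ψ (π e') := by
    intro ψ h0
    have hns : ∀ F, F ≠ F1 v → F ≠ F2 v → M.del (fun e => ψ (π e)) v F = 0 := by
      intro F hF1 hF2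
      have hsel : ¬ Sel S F1 F2 v F := fun h => h.2.elim hF1 hF2
      by_cases hc : ∃ e, M.AtC v F e
      · obtain ⟨e, he⟩ := hc
        obtain ⟨e', hne, h4, h5⟩ := hM.corner v e F he.1 he.2
        rw [hM.del_pair hne ⟨h4, h5⟩ he, hπ e' e v F ⟨h4, h5⟩ he hsel, CharTwo.add_self_eq_zero]
      · simp only [not_exists] at hc
        simp [del, hc]
    have hrow := hM.del_row (fun e => ψ (π e)) v
    have hF2 : M.del (fun e => ψ (π e)) v (F2 v) = 0 := by
      rw [Finset.sum_eq_single (F2 v)] at hrow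
      · exact hrow
      · intro F _ hF
        by_cases hF1 : F = F1 v
        · rw [hF1]; exact h0
        · exact hns F hF1 hF
      · simp
    refine hM.const_at fun F => ?_
    by_cases hF1 : F = F1 v
    · rw [hF1]; exact h0
    · by_cases hF2' : F = F2 v
      · rw [hF2']; exact hF2
      · exact hns F hF1 hF2'
  let ψ1 : R → ZMod 2 := fun r => if r = π e1 then 1 else 0
  let ψ2 : R → ZMod 2 := fun r => if r = π e2 then 1 else 0
  have hz : ∀ a : ZMod 2, a ≠ 0 → a = 1 := by decide
  have ha : M.del (fun e => ψ1 (π e)) v (F1 v) = 1 := by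
    refine hz _ fun h0 => ?_
    have := key ψ1 h0 e1 e2 h1 h2
    simp [ψ1, h12.symm] at this
  have hb : M.del (fun e => ψ2 (π e)) v (F1 v) = 1 := by
    refine hz _ fun h0 => ?_
    have := key ψ2 h0 e2 e1 h2 h1
    simp [ψ2, h12] at this
  have hc : M.del (fun e => (ψ1 + ψ2) (π e)) v (F1 v) = 0 := by
    have : M.del (fun e => (ψ1 + ψ2) (π e)) v (F1 v) = M.del (fun e => ψ1 (π e)) v (F1 v) +
        M.del (fun e => ψ2 (π e)) v (F1 v) := by
      simp [del, Finset.sum_add_distrib]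
    rw [this, ha, hb]; decide
  have := key (ψ1 + ψ2) hc e1 e3 h1 h3
  simp [ψ1, ψ2, h12, h13.symm, h23.symm] at this

/-- regions with at most two special vertices are single edges. -/
theorem Good.bad (hM : M.Good) (h3 : 3 ≤ S.card)
    (hπ : ∀ e e' v F, M.AtC v F e → M.AtC v F e' → ¬ Sel S F1 F2 v F → π e = π e')
    {ρ : R} (hρ : (S.filter fun v => ∃ e, M.Inc e v ∧ π e = ρ).card ≤ 2) :
    (∀ e e', π e = ρ → π e' = ρ → e = e') ∧
      (∀ e, π e = ρ → M.src e ∈ S ∧ M.tgt e ∈ S) := by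
  obtain ⟨T, hT1, hT2, hT3⟩ := Finset.exists_subsuperset_card_eq
    (Finset.filter_subset (fun v => ∃ e, M.Inc e v ∧ π e = ρ) S) hρ (by omega : 2 ≤ S.card)
  obtain ⟨a, b, hab, rfl⟩ := Finset.card_eq_two.1 hT3
  obtain ⟨s, hs, hsT⟩ := Finset.exists_mem_notMem_of_card_lt_card (s := {a, b}) (t := S) (by omega)
  simp only [Finset.mem_insert, Finset.mem_singleton, not_or] at hsT
  have hT : ∀ v ∈ S, (∃ e, M.Inc e v ∧ π e = ρ) → v = a ∨ v = b := by
    intro v hv h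
    have := hT1 (Finset.mem_filter.2 ⟨hv, h⟩)
    simpa using this
  have claim : ∀ e u, π e = ρ → M.Inc e u → u = a ∨ u = b := by
    intro e u he hu
    by_contra hcon
    rw [not_or] at hcon
    have hreach : (∃ f, M.Inc f s ∧ π f = ρ) ∧ s ≠ a ∧ s ≠ b := by
      have := hM.conn2 a b u s hab hcon.1 hcon.2 hsT.1 hsT.2
      clear hs
      induction this with
      | refl => exact ⟨⟨e, hu, he⟩, hsT⟩
      | @tail x y hx hxy ih =>
        obtain ⟨⟨g, hg1, hg2⟩, -⟩ := hxy
        by_cases hxa : x = a ∨ x = b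
        · exfalso
          rcases Relation.ReflTransGen.cases_tail hx with h | ⟨c, -, h⟩
          · subst h; exact hxa.elim hcon.1 hcon.2
          · exact hxa.elim h.2.1 h.2.2
        · obtain ⟨⟨f, hf1, hf2⟩, -⟩ := ih (not_or.1 hxa)
          have hxS : x ∉ S := fun hxS => hxa (hT x hxS ⟨f, hf1, hf2⟩)
          exact ⟨⟨g, hg2, (hM.nonS hπ hxS hg1 hf1).trans hf2⟩, hsT⟩
    exact (hT s hs hreach.1).elim hsT.1 hsT.2
  have hS2 : a ∈ S ∧ b ∈ S := ⟨hT2 (by simp), hT2 (by simp)⟩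
  have hends : ∀ e, π e = ρ → M.Inc e a ∧ M.Inc e b := by
    intro e he
    have h1 := claim e (M.src e) he (Or.inl rfl)
    have h2 := claim e (M.tgt e) he (Or.inr rfl)
    have := hM.ne e
    rcases h1 with h1 | h1 <;> rcases h2 with h2 | h2
    · exact absurd (h1.trans h2.symm) this
    · exact ⟨Or.inl h1, Or.inr h2⟩
    · exact ⟨Or.inr h2, Or.inl h1⟩
    · exact absurd (h1.trans h2.symm) this
  refine ⟨fun e e' he he' => hM.simple e e' a b hab (hends e he).1 (hends e he).2 (hends e' he').1
    (hends e' he').2, fun e he => ?_⟩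
  constructor
  · rcases claim e (M.src e) he (Or.inl rfl) with h | h
    · rw [h]; exact hS2.1
    · rw [h]; exact hS2.2
  · rcases claim e (M.tgt e) he (Or.inr rfl) with h | h
    · rw [h]; exact hS2.1
    · rw [h]; exact hS2.2

end

theorem Good.bound (hM : M.Good) (hS : M.Selection S P F1 F2) (h3 : 3 ≤ S.card) :
    S.card ≤ 6 * P.card := by
  let rel : E → E → Prop := fun e e' => ∃ v F, M.AtC v F e ∧ M.AtC v F e' ∧ ¬ Sel S F1 F2 v F
  let R := Quot rel
  let π : E → R := Quot.mk rel
  haveI : Fintype R := Fintype.ofSurjective π Quot.mk_surjective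
  have hπ : ∀ e e' v F, M.AtC v F e → M.AtC v F e' → ¬ Sel S F1 F2 v F → π e = π e' :=
    fun e e' v F h1 h2 h3 => Quot.sound ⟨v, F, h1, h2, h3⟩
  have hr := hM.regions hS π (fun φ hφ => ⟨Quot.lift φ fun e e' ⟨v, F, h1, h2, h3⟩ =>
    hφ e e' v F h1 h2 h3, fun e => rfl⟩)
  let tch : V → R → Prop := fun v ρ => ∃ e, M.Inc e v ∧ π e = ρ
  have hsurj : ∀ ρ : R, ∃ e, π e = ρ := fun ρ => Quot.mk_surjective ρ
  let B : Finset R := Finset.univ.filter fun ρ => (S.filter fun v => tch v ρ).card ≤ 2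
  have hB : ∀ ρ ∈ B, (∀ e e', π e = ρ → π e' = ρ → e = e') ∧
      (∀ e, π e = ρ → M.src e ∈ S ∧ M.tgt e ∈ S) := by
    intro ρ hρ
    exact hM.bad h3 hπ (Finset.mem_filter.1 hρ).2
  -- each special vertex touches at most two regions
  have hN : ∀ v ∈ S, (Finset.univ.filter fun ρ => tch v ρ).card ≤ 2 := by
    intro v hv
    by_contra hcon
    rw [not_le, Finset.two_lt_card] at hcon
    obtain ⟨a, ha, b, hb, c, hc, hab, hac, hbc⟩ := hcon
    simp only [Finset.mem_filter, Finset.mem_univ, true_and] at ha hb hc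
    obtain ⟨e1, h1, rfl⟩ := ha
    obtain ⟨e2, h2, rfl⟩ := hb
    obtain ⟨e3, h3, rfl⟩ := hc
    exact hM.touch hS hπ hv h1 h2 h3 hab hac hbc
  -- at most one bad region
  have hNB : ∀ v ∈ S, (B.filter fun ρ => tch v ρ).card ≤ 1 := by
    intro v hv
    rw [Finset.card_le_one]
    intro a ha b hb
    by_contra hab
    simp only [Finset.mem_filter] at ha hb
    obtain ⟨ha, e1, h1, rfl⟩ := ha
    obtain ⟨hb, e2, h2, rfl⟩ := hb
    have hsub : (Finset.univ.filter fun e => M.Inc e v) ⊆ {e1, e2} := by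
      intro e he
      simp only [Finset.mem_filter, Finset.mem_univ, true_and] at he
      simp only [Finset.mem_insert, Finset.mem_singleton]
      by_cases hc1 : π e = π e1
      · left; exact (hB _ ha).1 e e1 hc1 rfl
      · by_cases hc2 : π e = π e2
        · right; exact (hB _ hb).1 e e2 hc2 rfl
        · exact (hM.touch hS hπ hv h1 h2 he hab (Ne.symm hc1) (Ne.symm hc2)).elim
    have := Finset.card_le_card hsub
    have h4 := hM.deg v
    have h5 := Finset.card_le_two (a := e1) (b := e2)
    omega
  have hBT : ∀ ρ ∈ B, 2 ≤ (S.filter fun v => tch v ρ).card := by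
    intro ρ hρ
    obtain ⟨e, he⟩ := hsurj ρ
    have h1 := (hB ρ hρ).2 e he
    have hsub : ({M.src e, M.tgt e} : Finset V) ⊆ S.filter fun v => tch v ρ := by
      intro v hv
      simp only [Finset.mem_insert, Finset.mem_singleton] at hv
      rw [Finset.mem_filter]
      rcases hv with rfl | rfl
      · exact ⟨h1.1, e, Or.inl rfl, he⟩
      · exact ⟨h1.2, e, Or.inr rfl, he⟩
    calc 2 = ({M.src e, M.tgt e} : Finset V).card := (Finset.card_pair (hM.ne e)).symm
      _ ≤ _ := Finset.card_le_card hsub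
  have dc1 : 2 * B.card ≤ S.card := by
    have h := Finset.sum_card_bipartiteAbove_eq_sum_card_bipartiteBelow (s := S) (t := B) tch
    simp only [Finset.bipartiteAbove, Finset.bipartiteBelow] at h
    have h1 := Finset.card_nsmul_le_sum B _ 2 hBT
    have h2 := Finset.sum_le_card_nsmul S _ 1 hNB
    simp only [smul_eq_mul] at h1 h2
    omega
  have dc2 : 2 * B.card + 3 * (Finset.univ \ B).card ≤ 2 * S.card := by
    have h := Finset.sum_card_bipartiteAbove_eq_sum_card_bipartiteBelow (s := S)
      (t := (Finset.univ : Finset R)) tch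
    simp only [Finset.bipartiteAbove, Finset.bipartiteBelow] at h
    rw [← Finset.sum_sdiff (Finset.subset_univ B)] at h
    have h1 := Finset.card_nsmul_le_sum B _ 2 hBT
    have h2 := Finset.sum_le_card_nsmul S _ 2 hN
    have h4 := Finset.card_nsmul_le_sum (Finset.univ \ B) (fun ρ => (S.filter fun v => tch v ρ).card) 3
      (by
        intro ρ hρ
        simp only [Finset.mem_sdiff, Finset.mem_univ, true_and, B, Finset.mem_filter, not_le] at hρ
        exact hρ)
    simp only [smul_eq_mul] at h1 h2 h4
    omega
  have hcard : Fintype.card R = B.card + (Finset.univ \ B).card := by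
    have := Finset.card_sdiff_add_card_eq_card (Finset.subset_univ B)
    rw [Finset.card_univ] at this
    omega
  omega

end

end Comb
end PF

open Set Topology

namespace PF

noncomputable def hh : ℂ ≃ₜ ℝ × ℝ := Complex.equivRealProdCLM.toHomeomorph

theorem conn_homeo {U : Set (ℝ × ℝ)} {p z : ℝ × ℝ} (hp : p ∈ U) :
    z ∈ connectedComponentIn U p ↔ Conn (hh ⁻¹' U) (hh.symm p) (hh.symm z) := by
  constructor
  · intro hz
    refine ⟨hh.symm '' connectedComponentIn U p, ?_,
      isPreconnected_connectedComponentIn.image _ hh.symm.continuous.continuousOn,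
      mem_image_of_mem _ (mem_connectedComponentIn hp), mem_image_of_mem _ hz⟩
    rintro _ ⟨w, hw, rfl⟩
    simpa using connectedComponentIn_subset U p hw
  · rintro ⟨t, ht, hc, h1, h2⟩
    have : hh '' t ⊆ connectedComponentIn U p := by
      refine IsPreconnected.subset_connectedComponentIn (hc.image _ hh.continuous.continuousOn)
        ⟨_, h1, by simp⟩ ?_
      rintro _ ⟨w, hw, rfl⟩
      exact ht hw
    exact this ⟨_, h2, by simp⟩

variable {V : Type} {G : SimpleGraph V}

/-- The embedding transported to `ℂ`. -/
theorem exists_CEmb (Φ : PlaneEmbedding G) : ∃ M : CEmb V G.edgeSet,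
    (∀ v, M.pt v = hh.symm (Φ.vmap v)) ∧ (∀ e, range (M.γ e) = hh ⁻¹' Φ.arc e) ∧
    ∀ e : G.edgeSet, (e : Sym2 V) = s(M.src e, M.tgt e) := by
  choose f hf hi hr u v huv h0 h1 using Φ.arc_path
  have hrange : ∀ e, range (hh.symm ∘ f e) = hh ⁻¹' Φ.arc e := by
    intro e
    rw [range_comp, hr, hh.symm.image_eq_preimage_symm]; rfl
  refine ⟨{ pt := fun v => hh.symm (Φ.vmap v)
            pt_inj := hh.symm.injective.comp Φ.vmap_inj
            γ := fun e => hh.symm ∘ f e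
            cont := fun e => hh.symm.continuous.comp (hf e)
            inj := fun e => hh.symm.injective.comp (hi e)
            src := u
            tgt := v
            γ0 := fun e => congrArg hh.symm (h0 e)
            γ1 := fun e => congrArg hh.symm (h1 e)
            inter := ?_
            pt_mem := ?_ }, fun _ => rfl, hrange, huv⟩
  · intro e e' hne z hz
    rw [hrange, hrange] at hz
    obtain ⟨x, -, hx⟩ := Φ.arc_inter e e' hne ⟨hz.1, hz.2⟩
    exact ⟨x, by simp [hx]⟩
  · intro e x hx
    rw [hrange] at hx
    have := Φ.vmap_mem_arc e x (by simpa using hx)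
    rw [huv] at this
    simpa using this

theorem mem_D {M : CEmb V G.edgeSet} (hM : ∀ e : G.edgeSet, (e : Sym2 V) = s(M.src e, M.tgt e))
    {e : G.edgeSet} {v : V} : e ∈ M.D v ↔ v ∈ (e : Sym2 V) := by
  rw [hM e, Sym2.mem_iff, CEmb.D]
  simp [eq_comm]

theorem lk_of_adj {M : CEmb V G.edgeSet} (hM : ∀ e : G.edgeSet, (e : Sym2 V) = s(M.src e, M.tgt e))
    {C : Set G.edgeSet} {u w : V} (h : G.Adj u w) (hC : (⟨s(u, w), h⟩ : G.edgeSet) ∈ C) :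
    M.Lk C u w := by
  refine ⟨_, hC, ?_⟩
  have : s(u, w) = s(M.src ⟨s(u, w), h⟩, M.tgt ⟨s(u, w), h⟩) := hM ⟨s(u, w), h⟩
  rw [Sym2.eq_iff] at this
  rcases this with ⟨h1, h2⟩ | ⟨h1, h2⟩
  · left; exact ⟨h1.symm, h2.symm⟩
  · right; exact ⟨h2.symm, h1.symm⟩

theorem induce_rtg {s : Set V} (hs : (G.induce s).Connected) {u w : V} (hu : u ∈ s) (hw : w ∈ s) :
    Relation.ReflTransGen (fun a b => G.Adj a b ∧ a ∈ s ∧ b ∈ s) u w := by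
  have := hs.preconnected ⟨u, hu⟩ ⟨w, hw⟩
  rw [SimpleGraph.reachable_iff_reflTransGen] at this
  have key : ∀ a b : s, Relation.ReflTransGen (G.induce s).Adj a b →
      Relation.ReflTransGen (fun a b => G.Adj a b ∧ a ∈ s ∧ b ∈ s) (a : V) (b : V) := by
    intro a b h
    induction h with
    | refl => exact .refl
    | @tail b c _ hb ih => exact ih.tail ⟨hb, b.2, c.2⟩
  exact key _ _ this

theorem rtg_mono {r r' : V → V → Prop} (h : ∀ a b, r a b → r' a b) {u w : V}
    (huw : Relation.ReflTransGen r u w) : Relation.ReflTransGen r' u w := by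
  induction huw with
  | refl => exact .refl
  | tail _ hb ih => exact ih.tail (h _ _ hb)

section
variable [Fintype V]

theorem deg_three (hG : Triconnected G) (hn : 4 ≤ Fintype.card V) (v : V) :
    3 ≤ {u | G.Adj v u}.ncard := by
  classical
  by_contra hcon
  rw [not_le] at hcon
  have hsub : (Finset.univ.filter fun u => G.Adj v u) ⊆ Finset.univ.erase v := by
    intro u hu
    simp only [Finset.mem_filter, Finset.mem_univ, true_and] at hu
    simpa using hu.ne'
  have hc : (Finset.univ.filter fun u => G.Adj v u).card ≤ 2 := by
    have : {u | G.Adj v u}.ncard = (Finset.univ.filter fun u => G.Adj v u).card := by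
      rw [← ncard_coe_finset]; congr 1; ext; simp
    omega
  have hce : (Finset.univ.erase v).card = Fintype.card V - 1 := by
    rw [Finset.card_erase_of_mem (Finset.mem_univ v), Finset.card_univ]
  obtain ⟨T, hT1, hT2, hT3⟩ := Finset.exists_subsuperset_card_eq hsub hc (by omega)
  obtain ⟨a, b, hab, rfl⟩ := Finset.card_eq_two.1 hT3
  obtain ⟨w, hw, hwT⟩ := Finset.exists_mem_notMem_of_card_lt_card (s := {a, b})
    (t := Finset.univ.erase v) (by omega)
  have ha := hT2 (Finset.mem_insert_self a {b})
  have hb := hT2 (Finset.mem_insert_of_mem (Finset.mem_singleton_self b) : b ∈ ({a, b} : Finset V))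
  simp only [Finset.mem_erase, Finset.mem_univ, and_true, Finset.mem_insert, Finset.mem_singleton,
    not_or] at ha hb hw hwT
  have h := induce_rtg (hG.2.2 a b hab) (u := v) (w := w) ⟨ha.symm, hb.symm⟩ hwT
  rcases Relation.ReflTransGen.cases_head h with h | ⟨c, ⟨h1, h2, h3⟩, -⟩
  · exact hw h.symm
  · have : c ∈ ({a, b} : Finset V) := hT1 (by simpa using h1)
    simp only [Finset.mem_insert, Finset.mem_singleton] at this
    exact this.elim h3.1 h3.2

theorem good_of {M : CEmb V G.edgeSet} (hM : ∀ e : G.edgeSet, (e : Sym2 V) = s(M.src e, M.tgt e))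
    (hG : Triconnected G) (hn : 4 ≤ Fintype.card V) : M.Good where
  cut := by
    classical
    intro v u w hu hw
    obtain ⟨x, -, hx⟩ := Finset.exists_mem_notMem_of_card_lt_card (s := {v, u, w})
      (t := (Finset.univ : Finset V)) (lt_of_le_of_lt Finset.card_le_three (by
        rw [Finset.card_univ]; omega))
    simp only [Finset.mem_insert, Finset.mem_singleton, not_or] at hx
    refine rtg_mono ?_ (induce_rtg (hG.2.2 v x (Ne.symm hx.1)) (u := u) (w := w)
      ⟨hu, Ne.symm hx.2.1⟩ ⟨hw, Ne.symm hx.2.2⟩)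
    rintro a b ⟨h, ha, hb⟩
    refine lk_of_adj hM h ?_
    rw [mem_compl_iff, mem_D hM, Sym2.mem_iff, not_or]
    exact ⟨ha.1.symm, hb.1.symm⟩
  deg := by
    intro v
    refine (deg_three hG hn v).trans ?_
    classical
    refine ncard_le_ncard_of_injOn (fun u => if h : G.Adj v u then (⟨s(v, u), h⟩ : G.edgeSet) else
      Classical.choice (by
        have := deg_three hG hn v
        obtain ⟨u, hu⟩ := nonempty_of_ncard_ne_zero (s := {u | G.Adj v u}) (by omega)
        exact ⟨⟨s(v, u), hu⟩⟩)) ?_ ?_ (toFinite _)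
    · intro u hu
      have hu : G.Adj v u := hu
      simp only [dif_pos hu]
      rw [mem_D hM]; simp
    · intro u hu w hw h
      have hu : G.Adj v u := hu
      have hw : G.Adj v w := hw
      simp only [dif_pos hu, dif_pos hw] at h
      have h2 : s(v, u) = s(v, w) := congrArg Subtype.val h
      exact Sym2.congr_right.1 h2
  tree := by
    classical
    obtain ⟨T, hTG, hT⟩ := hG.1.1.exists_isTree_le
    refine ⟨{e | (e : Sym2 V) ∈ T.edgeSet}, ?_, ?_⟩
    · have h1 := hT.card_edgeFinset
      rw [Nat.card_eq_fintype_card, ← h1, ← ncard_coe_finset, SimpleGraph.coe_edgeFinset]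
      congr 1
      rw [← ncard_image_of_injective _ Subtype.val_injective]
      congr 1
      ext e
      constructor
      · rintro ⟨e', he', rfl⟩; exact he'
      · intro he
        exact ⟨⟨e, SimpleGraph.edgeSet_mono hTG he⟩, he, rfl⟩
    · intro u w
      have := hT.connected.preconnected u w
      rw [SimpleGraph.reachable_iff_reflTransGen] at this
      refine rtg_mono ?_ this
      intro a b h
      exact lk_of_adj hM (hTG h) h

open Classical in
theorem comb_good {M : CEmb V G.edgeSet} (hM : ∀ e : G.edgeSet, (e : Sym2 V) = s(M.src e, M.tgt e))
    (hG : Triconnected G) (hn : 4 ≤ Fintype.card V) [Fintype M.Face] :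
    (Comb.mk M.src M.tgt M.AtF).Good := by
  have hg := good_of hM hG hn
  have hinc : ∀ e v, (Comb.mk M.src M.tgt M.AtF).Inc e v ↔ e ∈ M.D v := fun e v => Iff.rfl
  have hdeg : ∀ v, (Finset.univ.filter fun e => (Comb.mk M.src M.tgt M.AtF).Inc e v).card =
      (M.D v).ncard := by
    intro v; rw [← ncard_coe_finset]; congr 1; ext e; simp [hinc]
  have hlk : ∀ (C : Set G.edgeSet) u w, Relation.ReflTransGen (M.Lk C) u w →
      Relation.ReflTransGen (fun x y => ∃ e, (Comb.mk M.src M.tgt M.AtF).Inc e x ∧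
        (Comb.mk M.src M.tgt M.AtF).Inc e y) u w := by
    intro C u w h
    refine rtg_mono ?_ h
    rintro a b ⟨e, -, ⟨h1, h2⟩ | ⟨h1, h2⟩⟩
    · exact ⟨e, Or.inl h1, Or.inr h2⟩
    · exact ⟨e, Or.inr h2, Or.inl h1⟩
  haveI : Nonempty V := Fintype.card_pos_iff.1 (by omega)
  haveI : Nonempty G.edgeSet := by
    obtain ⟨v⟩ := ‹Nonempty V›
    have := hg.deg v
    obtain ⟨e, -⟩ := nonempty_of_ncard_ne_zero (s := M.D v) (by omega)
    exact ⟨e⟩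
  exact
  { ne := M.src_ne_tgt
    simple := by
      intro e e' a b hab h1 h2 h3 h4
      rw [hinc, mem_D hM] at h1 h2 h3 h4
      exact Subtype.ext (((Sym2.mem_and_mem_iff hab).1 ⟨h1, h2⟩).trans
        ((Sym2.mem_and_mem_iff hab).1 ⟨h3, h4⟩).symm)
    two := by
      intro e
      rw [← hg.two e, ← ncard_coe_finset]; congr 1; ext F; simp
    face := M.face_edgeF
    corner := by
      intro v e F he hF
      obtain ⟨e1, he1, hne⟩ := hg.other v e
      obtain ⟨e', h1, h2, h3⟩ := M.corner_twoF he he1 hne hF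
      exact ⟨e', h2, h1, h3⟩
    loc := by
      intro α v φ h e e' he he'
      exact M.local_connF φ (fun f hf f' hf' hF => h f f' hf hf' hF) e he e' he'
    euler := by
      have := hg.euler
      simpa only [Nat.card_eq_fintype_card] using this
    facesat := by
      intro v
      rw [hdeg]
      refine (hg.faces_at v).trans (le_of_eq ?_)
      rw [← ncard_coe_finset]; congr 1; ext F; simp [Comb.AtC, hinc]
    deg := by
      intro v; rw [hdeg]; exact hg.deg v
    conn := by
      obtain ⟨C0, -, h⟩ := hg.tree
      exact fun u w => hlk C0 u w (h u w)
    conn2 := by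
      intro a b u w hab h1 h2 h3 h4
      refine rtg_mono ?_ (induce_rtg (hG.2.2 a b hab) (u := u) (w := w) ⟨h1, h2⟩ ⟨h3, h4⟩)
      rintro x y ⟨h, -, hy⟩
      refine ⟨⟨⟨s(x, y), h⟩, ?_, ?_⟩, hy⟩
      · rw [hinc, mem_D hM]; simp
      · rw [hinc, mem_D hM]; simp }

theorem K_univ (Φ : PlaneEmbedding G) {M : CEmb V G.edgeSet}
    (hr : ∀ e, range (M.γ e) = hh ⁻¹' Φ.arc e) (hD : ∀ v, (M.D v).Nonempty) :
    M.W = hh ⁻¹' Φ.drawingᶜ := by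
  rw [CEmb.W, preimage_compl]
  congr 1
  ext z
  simp only [CEmb.K, PlaneEmbedding.drawing, mem_union, mem_iUnion, mem_univ, exists_const,
    mem_preimage, hr]
  constructor
  · rintro (h | ⟨v, rfl⟩)
    · simpa using h
    · obtain ⟨e, he⟩ := hD v
      refine ⟨e, ?_⟩
      have : M.pt v ∈ range (M.γ e) := by
        rcases he with h | h
        · exact ⟨0, by rw [M.γ0, h]⟩
        · exact ⟨1, by rw [M.γ1, h]⟩
      rw [hr] at this
      exact this
  · intro h
    left; simpa using h

theorem main_bound (hG : Triconnected G) (hn : 4 ≤ Fintype.card V) (Φ : PlaneEmbedding G)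
    (P : Set (Set (ℝ × ℝ))) (hP : ∀ F ∈ P, Φ.IsFace F) (hPf : P.Finite)
    (h3 : 3 ≤ {v : V | ∃ F₁ ∈ P, ∃ F₂ ∈ P, F₁ ≠ F₂ ∧ Φ.OnFace F₁ v ∧ Φ.OnFace F₂ v}.ncard) :
    {v : V | ∃ F₁ ∈ P, ∃ F₂ ∈ P, F₁ ≠ F₂ ∧ Φ.OnFace F₁ v ∧ Φ.OnFace F₂ v}.ncard ≤
      6 * P.ncard := by
  classical
  obtain ⟨M, hpt, hr, hM⟩ := exists_CEmb Φ
  have hg := good_of hM hG hn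
  have hD : ∀ v, (M.D v).Nonempty := by
    intro v
    have := hg.deg v
    exact nonempty_of_ncard_ne_zero (by omega)
  have hW := K_univ Φ hr hD
  haveI : Nonempty G.edgeSet := by
    obtain ⟨v⟩ : Nonempty V := Fintype.card_pos_iff.1 (by omega)
    obtain ⟨e, -⟩ := hD v
    exact ⟨e⟩
  haveI : Finite M.Face := M.finite_face
  haveI : Fintype M.Face := Fintype.ofFinite _
  have hC := comb_good hM hG hn
  -- the map from faces
  have hex : ∀ F, ∃ Q : M.Face, Φ.IsFace F → ∀ z (hz : z ∈ M.W), M.fc z hz = Q ↔ hh z ∈ F := by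
    intro F
    by_cases hF : Φ.IsFace F
    · obtain ⟨p, hp, rfl⟩ := hF
      have hpW : hh.symm p ∈ M.W := by rw [hW]; simpa using hp
      refine ⟨M.fc (hh.symm p) hpW, fun _ z hz => ?_⟩
      rw [M.fc_eq, conn_homeo hp, ← hW]
      simp only [Homeomorph.symm_apply_apply]
      exact ⟨fun h => h.symm, fun h => h.symm⟩
    · obtain ⟨z, -, hz⟩ := M.exists_W isOpen_univ univ_nonempty
      exact ⟨M.fc z hz, fun h => absurd h hF⟩
  choose Q hQ using hex
  have hFsub : ∀ F, Φ.IsFace F → F ⊆ Φ.drawingᶜ := by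
    rintro _ ⟨p, hp, rfl⟩; exact connectedComponentIn_subset _ _
  have hQinj : ∀ F F', Φ.IsFace F → Φ.IsFace F' → Q F = Q F' → F = F' := by
    intro F F' hF hF' h
    ext z
    constructor
    · intro hz
      have hzW : hh.symm z ∈ M.W := by rw [hW]; simpa using hFsub F hF hz
      have := (hQ F hF _ hzW).2 (by simpa using hz)
      rw [h, hQ F' hF'] at this
      simpa using this
    · intro hz
      have hzW : hh.symm z ∈ M.W := by rw [hW]; simpa using hFsub F' hF' hz
      have := (hQ F' hF' _ hzW).2 (by simpa using hz)
      rw [← h, hQ F hF] at this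
      simpa using this
  have hcor : ∀ F v, Φ.IsFace F → Φ.OnFace F v → ∃ e, e ∈ M.D v ∧ M.AtF e (Q F) := by
    intro F v hF hv
    obtain ⟨x, hx, hxQ⟩ := M.fc_surj (Q F)
    rw [← hxQ]
    refine M.frontier_at (hD v) hx ?_
    have h1 : {z | Conn M.W x z} = hh ⁻¹' F := by
      ext z
      constructor
      · intro hz
        rw [mem_preimage, ← hQ F hF z (Conn.right hz), ← hxQ, M.fc_eq]
        exact Conn.symm hz
      · intro hz
        have hzW : z ∈ M.W := by rw [hW]; exact hFsub F hF hz
        have := (hQ F hF z hzW).2 hz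
        rw [← hxQ, M.fc_eq] at this
        exact this.symm
    rw [h1, ← hh.preimage_closure, hpt]
    simpa using frontier_subset_closure hv
  set S := {v : V | ∃ F₁ ∈ P, ∃ F₂ ∈ P, F₁ ≠ F₂ ∧ Φ.OnFace F₁ v ∧ Φ.OnFace F₂ v} with hS
  have hsel : ∀ v, ∃ F₁ F₂, v ∈ S → F₁ ∈ P ∧ F₂ ∈ P ∧ F₁ ≠ F₂ ∧ Φ.OnFace F₁ v ∧ Φ.OnFace F₂ v := by
    intro v
    by_cases hv : v ∈ S
    · obtain ⟨F1, h1, F2, h2, h⟩ := hv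
      exact ⟨F1, F2, fun _ => ⟨h1, h2, h⟩⟩
    · exact ⟨∅, ∅, fun h => absurd h hv⟩
  choose f1 f2 hf using hsel
  have hSc : S.ncard = S.toFinset.card := ncard_eq_toFinset_card' S
  have hb := hC.bound (S := S.toFinset) (P := hPf.toFinset.image Q) (F1 := fun v => Q (f1 v))
    (F2 := fun v => Q (f2 v))
    { ne := by
        intro v hv h
        obtain ⟨a, b, c, d, e⟩ := hf v (by simpa using hv)
        exact c (hQinj _ _ (hP _ a) (hP _ b) h)
      mem1 := by
        intro v hv
        obtain ⟨a, b, c, d, e⟩ := hf v (by simpa using hv)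
        exact Finset.mem_image_of_mem _ (by simpa using a)
      mem2 := by
        intro v hv
        obtain ⟨a, b, c, d, e⟩ := hf v (by simpa using hv)
        exact Finset.mem_image_of_mem _ (by simpa using b)
      cor1 := by
        intro v hv
        obtain ⟨a, b, c, d, e⟩ := hf v (by simpa using hv)
        exact hcor _ v (hP _ a) d
      cor2 := by
        intro v hv
        obtain ⟨a, b, c, d, e⟩ := hf v (by simpa using hv)
        exact hcor _ v (hP _ b) e } (by omega)
  have h4 : (hPf.toFinset.image Q).card ≤ P.ncard := by
    rw [ncard_eq_toFinset_card _ hPf]; exact Finset.card_image_le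
  omega

end

end PF

/-- there is a constant `c > 0` such that for every finite simple triconnected
graph `G` with a plane embedding `Φ` and every (finite) set `P` of faces of `Φ`, the number of
vertices lying on the boundaries of at least two faces in `P` is at most `c * |P|`. -/
theorem statement6 :
    ∃ c : ℕ, 0 < c ∧
      ∀ (V : Type) [Fintype V] (G : SimpleGraph V), Triconnected G →
        ∀ (Φ : PlaneEmbedding G) (P : Set (Set (ℝ × ℝ))),
          (∀ F ∈ P, Φ.IsFace F) → P.Finite →
          {v : V | ∃ F₁ ∈ P, ∃ F₂ ∈ P, F₁ ≠ F₂ ∧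
            Φ.OnFace F₁ v ∧ Φ.OnFace F₂ v}.ncard ≤ c * P.ncard := by
  refine ⟨6, by norm_num, ?_⟩
  intro V _ G hG Φ P hP hPf
  by_cases h4 : 4 ≤ {v : V | ∃ F₁ ∈ P, ∃ F₂ ∈ P, F₁ ≠ F₂ ∧
            Φ.OnFace F₁ v ∧ Φ.OnFace F₂ v}.ncard
  · refine PF.main_bound hG ?_ Φ P hP hPf (by omega)
    have := Set.ncard_le_card {v : V | ∃ F₁ ∈ P, ∃ F₂ ∈ P, F₁ ≠ F₂ ∧
            Φ.OnFace F₁ v ∧ Φ.OnFace F₂ v}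
    rw [Nat.card_eq_fintype_card] at this
    omega
  · rcases Set.eq_empty_or_nonempty {v : V | ∃ F₁ ∈ P, ∃ F₂ ∈ P, F₁ ≠ F₂ ∧
            Φ.OnFace F₁ v ∧ Φ.OnFace F₂ v} with h | ⟨v, F1, h1, F2, h2, hne, -⟩
    · rw [h, Set.ncard_empty]; exact Nat.zero_le _
    · have : 1 < P.ncard := (Set.one_lt_ncard_iff hPf).2 ⟨F1, F2, h1, h2, hne⟩
      omega
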